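/- arXiv:0906.2614 — 5 statements merged into one kernel-verified Lean document; each statement's English description precedes it below -/
import Mathlib

section
/- Martin-Löf's universal test theorem: there exists an effectively null set U ⊆ (ℕ → Bool) that is largest, i.e., every effectively null set X ⊆ (ℕ → Bool) satisfies X ⊆ U. -/
open Filter MeasureTheory Set
open scoped ENNReal

/-- The first `n` bits of `ω`, i.e. the list `[ω 0, …, ω (n-1)]`. -/
def prefixFn (ω : ℕ → Bool) (n : ℕ) : List Bool := List.ofFn fun i : Fin n => ω i

/-- `α` has limit frequency `p`: the fraction of `true`s among the first `N` terms
tends to `p` as `N → ∞`. -/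
def LimitFreq (α : ℕ → Bool) (p : ℝ) : Prop :=
  Tendsto (fun N => (((Finset.range N).filter fun i => α i = true).card : ℝ) / N)
    atTop (nhds p)

/-- The set of indices `i` such that the selection rule `s` selects the term `ω i`. -/
def SelectedIndices (s : List Bool → Bool) (ω : ℕ → Bool) : Set ℕ :=
  {i | s (prefixFn ω i) = true}

/-- The subsequence selected by `s` from `ω`: the selected terms, in increasing order of
index (meaningful when the selected index set is infinite). -/
noncomputable def SelectedSeq (s : List Bool → Bool) (ω : ℕ → Bool) : ℕ → Bool :=
  fun n => ω (Nat.nth (· ∈ SelectedIndices s ω) n)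

/-- Requirement II for the selection rule `s` with limit `p`: the subsequence selected by
`s` is finite or has limit frequency `p`. -/
def SatisfiesII (s : List Bool → Bool) (ω : ℕ → Bool) (p : ℝ) : Prop :=
  (SelectedIndices s ω).Finite ∨ LimitFreq (SelectedSeq s ω) p

/-- A (non-negative) martingale. -/
def IsMartingale (m : List Bool → ℝ) : Prop :=
  (∀ x, 0 ≤ m x) ∧ ∀ x, m x = (m (x ++ [false]) + m (x ++ [true])) / 2

/-- A (non-negative) supermartingale. -/
def IsSupermartingale (m : List Bool → ℝ) : Prop :=
  (∀ x, 0 ≤ m x) ∧ ∀ x, (m (x ++ [false]) + m (x ++ [true])) / 2 ≤ m x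

/-- `m` wins against `ω`: the values of `m` on the prefixes of `ω` are unbounded. -/
def Wins (m : List Bool → ℝ) (ω : ℕ → Bool) : Prop :=
  ∀ C : ℝ, ∃ n, C < m (prefixFn ω n)

/-- The cylinder of all infinite sequences extending the finite string `w`. -/
def cyl (w : List Bool) : Set (ℕ → Bool) := {ω | prefixFn ω w.length = w}

/-- `μ` is the uniform (fair-coin) measure on Cantor space, i.e. the infinite product
over `ℕ` of the uniform measure on `Bool`; it is characterized by its values on
cylinders: `μ (cyl w) = 2 ^ (- length w)`. -/
def IsUniformMeasure (μ : Measure (ℕ → Bool)) : Prop :=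
  ∀ w : List Bool, μ (cyl w) = ((2 : ℝ≥0∞) ^ w.length)⁻¹

/-- `X` is an effectively null set: some computable `g` produces, for every `k`, a
sequence of (optional) strings whose cylinders cover `X` and whose total measure is at
most `2^(-k)`. -/
def EffNull (X : Set (ℕ → Bool)) : Prop :=
  ∃ g : ℕ → ℕ → Option (List Bool), Computable₂ g ∧
    ∀ k : ℕ,
      (X ⊆ ⋃ n : ℕ, ⋃ w ∈ g k n, cyl w) ∧
      (∑' n : ℕ, ((g k n).elim 0 fun w => ((2 : ℝ≥0∞) ^ w.length)⁻¹)) ≤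
        ((2 : ℝ≥0∞) ^ k)⁻¹

/-- `ω` is Martin-Löf random: it belongs to no effectively null set. -/
def MLRandom (ω : ℕ → Bool) : Prop := ∀ X : Set (ℕ → Bool), EffNull X → ω ∉ X

/-- A canonical `Primcodable` structure on `ℚ`, via its canonical enumeration. -/
instance : Primcodable ℚ := Primcodable.ofEquiv ℕ (Denumerable.eqv ℚ)

/-- `f` is lower semicomputable: it is the pointwise supremum of a computable family of
rationals, nondecreasing in the second argument. -/
def LowerSemicomputableFn (f : List Bool → ℝ) : Prop :=
  ∃ g : List Bool → ℕ → ℚ, Computable₂ g ∧ (∀ x, Monotone fun n => g x n) ∧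
    ∀ x, f x = ⨆ n, ((g x n : ℝ))

/-- `f` is computable: some computable family of rationals approximates it within
`2^(-n)`. -/
def ComputableFn (f : List Bool → ℝ) : Prop :=
  ∃ g : List Bool → ℕ → ℚ, Computable₂ g ∧
    ∀ x n, |((g x n : ℝ)) - f x| ≤ (2 : ℝ) ^ (-(n : ℤ))

namespace EffNull

/-- The measure of the cylinder named by an optional string. -/
noncomputable def weight (o : Option (List Bool)) : ℝ≥0∞ :=
  o.elim 0 fun w => ((2 : ℝ≥0∞) ^ w.length)⁻¹

/-- A pair `(L, S)` encodes the dyadic number `S / 2 ^ L`; this adds `2 ^ (- length w)` to it. -/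
def addWeight (p : ℕ × ℕ) (o : Option (List Bool)) : ℕ × ℕ :=
  Option.casesOn o p fun w => (p.1 + w.length, p.2 * 2 ^ w.length + 2 ^ p.1)

/-- The dyadic representation of the total weight of the first `t` terms of `f`. -/
def partialWeight (f : ℕ → Option (List Bool)) (t : ℕ) : ℕ × ℕ :=
  Nat.rec (0, 0) (fun n p => addWeight p (f n)) t

/-- The sequence `f`, cut off as soon as its total weight would exceed `2 ^ (-j)`. -/
def truncate (f : ℕ → Option (List Bool)) (j t : ℕ) : Option (List Bool) :=
  if (partialWeight f (t + 1)).2 * 2 ^ j ≤ 2 ^ (partialWeight f (t + 1)).1 then f t else none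

/-- The output at argument `(j, i)` of the program `c`, listed at the time `s` with
`t = Nat.pair s i` if the computation stops exactly then. -/
def listing (c : Nat.Partrec.Code) (j t : ℕ) : Option (List Bool) :=
  if (Nat.Partrec.Code.evaln t.unpair.1 c (Nat.pair j t.unpair.2)).isSome then none
  else (Nat.Partrec.Code.evaln (t.unpair.1 + 1) c (Nat.pair j t.unpair.2)).bind
    fun x => (Encodable.decode (α := Option (List Bool)) x).bind id

/-- The universal test: the `e`-th program, truncated at weight `2 ^ (-(k + e + 1))`. -/
def universal (k n : ℕ) : Option (List Bool) :=
  truncate (listing (Denumerable.ofNat Nat.Partrec.Code n.unpair.1) (k + n.unpair.1 + 1))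
    (k + n.unpair.1 + 1) n.unpair.2

theorem primrec_two_pow : Primrec fun n : ℕ => 2 ^ n :=
  (Primrec₂.unpaired'.1 Nat.Primrec.pow).comp (Primrec.const 2) Primrec.id

theorem primrec₂_addWeight : Primrec₂ addWeight := by
  unfold addWeight
  refine Primrec.option_casesOn Primrec.snd Primrec.fst ?_
  have hp : Primrec fun q : ((ℕ × ℕ) × Option (List Bool)) × List Bool => q.1.1 :=
    Primrec.fst.comp Primrec.fst
  have hl : Primrec fun q : ((ℕ × ℕ) × Option (List Bool)) × List Bool => q.2.length :=
    Primrec.list_length.comp Primrec.snd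
  exact (Primrec.nat_add.comp (Primrec.fst.comp hp) hl).pair
    (Primrec.nat_add.comp
      (Primrec.nat_mul.comp (Primrec.snd.comp hp) (primrec_two_pow.comp hl))
      (primrec_two_pow.comp (Primrec.fst.comp hp)))

theorem primrec_partialWeight {α : Type*} [Primcodable α] {f : α → ℕ → Option (List Bool)}
    {t : α → ℕ} (hf : Primrec₂ f) (ht : Primrec t) :
    Primrec fun a => partialWeight (f a) (t a) :=
  Primrec.nat_rec' ht (Primrec.const (0, 0))
    (primrec₂_addWeight.comp (Primrec.snd.comp Primrec.snd)
      (hf.comp Primrec.fst (Primrec.fst.comp Primrec.snd))).to₂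

theorem primrec_truncate {α : Type*} [Primcodable α] {f : α → ℕ → Option (List Bool)}
    {j t : α → ℕ} (hf : Primrec₂ f) (hj : Primrec j) (ht : Primrec t) :
    Primrec fun a => truncate (f a) (j a) (t a) := by
  have hw := primrec_partialWeight hf (Primrec.succ.comp ht)
  exact Primrec.ite
    (Primrec.nat_le.comp
      (Primrec.nat_mul.comp (Primrec.snd.comp hw) (primrec_two_pow.comp hj))
      (primrec_two_pow.comp (Primrec.fst.comp hw)))
    (hf.comp Primrec.id ht) (Primrec.const none)

theorem primrec_listing {α : Type*} [Primcodable α] {c : α → Nat.Partrec.Code} {j t : α → ℕ}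
    (hc : Primrec c) (hj : Primrec j) (ht : Primrec t) :
    Primrec fun a => listing (c a) (j a) (t a) := by
  have hs : Primrec fun a => (t a).unpair.1 := Primrec.fst.comp (Primrec.unpair.comp ht)
  have hn : Primrec fun a => Nat.pair (j a) (t a).unpair.2 :=
    Primrec₂.natPair.comp hj (Primrec.snd.comp (Primrec.unpair.comp ht))
  have hev {s : α → ℕ} (hs : Primrec s) : Primrec fun a =>
      Nat.Partrec.Code.evaln (s a) (c a) (Nat.pair (j a) (t a).unpair.2) :=
    Nat.Partrec.Code.primrec_evaln.comp ((hs.pair hc).pair hn)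
  exact Primrec.ite (Primrec.eq.comp (Primrec.option_isSome.comp (hev hs)) (Primrec.const true))
    (Primrec.const none)
    (Primrec.option_bind (hev (Primrec.succ.comp hs))
      (Primrec.option_bind (Primrec.decode.comp Primrec.snd) Primrec.snd))

theorem primrec₂_universal : Primrec₂ universal := by
  have he : Primrec fun p : ℕ × ℕ => p.2.unpair.1 :=
    Primrec.fst.comp (Primrec.unpair.comp Primrec.snd)
  have hj : Primrec fun p : ℕ × ℕ => p.1 + p.2.unpair.1 + 1 :=
    Primrec.succ.comp (Primrec.nat_add.comp Primrec.fst he)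
  exact primrec_truncate
    (primrec_listing ((Primrec.ofNat Nat.Partrec.Code).comp (he.comp Primrec.fst))
      (hj.comp Primrec.fst) Primrec.snd)
    hj (Primrec.snd.comp (Primrec.unpair.comp Primrec.snd))

theorem sum_weight_eq (f : ℕ → Option (List Bool)) (t : ℕ) :
    ∑ i ∈ Finset.range t, weight (f i) =
      (partialWeight f t).2 * ((2 : ℝ≥0∞) ^ (partialWeight f t).1)⁻¹ := by
  induction t with
  | zero => simp [partialWeight]
  | succ t ih =>
    have hstep : partialWeight f (t + 1) = addWeight (partialWeight f t) (f t) := rfl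
    rw [Finset.sum_range_succ, ih, hstep]
    generalize partialWeight f t = p
    have h (n : ℕ) : (2 : ℝ≥0∞) ^ n * (2 ^ n)⁻¹ = 1 :=
      ENNReal.mul_inv_cancel (by simp) (by simp)
    cases f t with
    | none => simp [weight, addWeight]
    | some w =>
      simp only [weight, addWeight, Option.elim]
      push_cast
      rw [pow_add, ENNReal.mul_inv (by simp) (by simp)]
      calc _ = (p.2 : ℝ≥0∞) * (2 ^ p.1)⁻¹ * (2 ^ w.length * (2 ^ w.length)⁻¹) +
            2 ^ p.1 * (2 ^ p.1)⁻¹ * (2 ^ w.length)⁻¹ := by simp only [h, mul_one, one_mul]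
        _ = _ := by ring

theorem truncate_eq (f : ℕ → Option (List Bool)) (j t : ℕ) :
    truncate f j t =
      if ∑ i ∈ Finset.range (t + 1), weight (f i) ≤ ((2 : ℝ≥0∞) ^ j)⁻¹ then f t else none := by
  rw [truncate, sum_weight_eq]
  refine if_congr ?_ rfl rfl
  rw [← div_eq_mul_inv, ENNReal.div_le_iff (by simp) (by simp), mul_comm (_⁻¹), ← div_eq_mul_inv,
    ENNReal.le_div_iff_mul_le (by simp) (by simp)]
  exact_mod_cast Iff.rfl

theorem tsum_weight_truncate_le (f : ℕ → Option (List Bool)) (j : ℕ) :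
    ∑' t, weight (truncate f j t) ≤ ((2 : ℝ≥0∞) ^ j)⁻¹ := by
  refine ENNReal.tsum_le_of_sum_range_le fun t => ?_
  induction t with
  | zero => simp
  | succ t ih =>
    by_cases h : ∑ i ∈ Finset.range (t + 1), weight (f i) ≤ ((2 : ℝ≥0∞) ^ j)⁻¹
    · refine (Finset.sum_le_sum fun i _ => ?_).trans h
      rw [truncate_eq]
      split_ifs <;> simp [weight]
    · rw [Finset.sum_range_succ, truncate_eq, if_neg h]
      simpa [weight] using ih

theorem truncate_eq_self {f : ℕ → Option (List Bool)} {j : ℕ}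
    (h : ∑' t, weight (f t) ≤ ((2 : ℝ≥0∞) ^ j)⁻¹) (t : ℕ) : truncate f j t = f t := by
  rw [truncate_eq, if_pos ((ENNReal.sum_le_tsum _).trans h)]

theorem tsum_pair {f : ℕ → ℝ≥0∞} : ∑' n, f n = ∑' (a) (b), f (Nat.pair a b) := by
  rw [← ENNReal.tsum_prod (f := fun a b => f (Nat.pair a b)),
    ← Nat.pairEquiv.tsum_eq f]
  rfl

theorem tsum_weight_universal_le (k : ℕ) :
    ∑' n, weight (universal k n) ≤ ((2 : ℝ≥0∞) ^ k)⁻¹ := by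
  rw [tsum_pair]
  calc _ ≤ ∑' e : ℕ, ((2 : ℝ≥0∞) ^ (k + e + 1))⁻¹ := by
        refine ENNReal.tsum_le_tsum fun e => ?_
        simp only [universal, Nat.unpair_pair]
        exact tsum_weight_truncate_le _ _
    _ = ((2 : ℝ≥0∞) ^ k)⁻¹ * ∑' e : ℕ, (2⁻¹ : ℝ≥0∞) ^ (e + 1) := by
        rw [← ENNReal.tsum_mul_left]
        refine tsum_congr fun e => ?_
        rw [add_assoc, pow_add, ENNReal.mul_inv (by simp) (by simp),
          ENNReal.inv_pow (n := e + 1)]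
    _ = _ := by
        rw [ENNReal.tsum_geometric_add_one, ENNReal.one_sub_inv_two, inv_inv,
          ENNReal.inv_mul_cancel (by simp) (by simp), mul_one]

theorem exists_code_of_computable₂ {g : ℕ → ℕ → Option (List Bool)} (hg : Computable₂ g) :
    ∃ c : Nat.Partrec.Code,
      ∀ j i, c.eval (Nat.pair j i) = Part.some (Encodable.encode (g j i)) := by
  obtain ⟨c, hc⟩ := Nat.Partrec.Code.exists_code.1 hg
  refine ⟨c, fun j i => ?_⟩
  have h : Encodable.decode (α := ℕ × ℕ) (Nat.pair j i) = some (j, i) := Encodable.encodek (j, i)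
  rw [hc]
  change (Part.ofOption (Encodable.decode (α := ℕ × ℕ) (Nat.pair j i))).bind
    (fun a => (Part.some (g a.1 a.2)).map Encodable.encode) = _
  rw [h]
  simp

/-- A terminating computation of a code has an exact halting time. -/
theorem exists_halting_time {c : Nat.Partrec.Code} {n x : ℕ} (h : c.eval n = Part.some x) :
    ∃ s, ∀ r, Nat.Partrec.Code.evaln r c n = if s < r then some x else none := by
  have hex : ∃ s, x ∈ Nat.Partrec.Code.evaln s c n :=
    Nat.Partrec.Code.evaln_complete.1 (by simp [h])
  classical
  obtain ⟨s, hs⟩ : ∃ s, Nat.find hex = s + 1 := by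
    refine Nat.exists_eq_succ_of_ne_zero fun h0 => ?_
    have := Nat.find_spec hex
    rw [h0] at this
    simp [Nat.Partrec.Code.evaln] at this
  have hr (r : ℕ) : Nat.Partrec.Code.evaln r c n = if s < r then some x else none := by
    split_ifs with hlt
    · exact Nat.Partrec.Code.evaln_mono (by omega) (Nat.find_spec hex)
    · refine Option.eq_none_iff_forall_not_mem.2 fun y hy => ?_
      have hxy : y = x := by simpa [h] using Nat.Partrec.Code.evaln_sound hy
      exact Nat.find_min hex (by omega) (hxy ▸ hy)
  exact ⟨s, hr⟩

theorem exists_listing_eq {c : Nat.Partrec.Code} {j i : ℕ} {o : Option (List Bool)}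
    (h : c.eval (Nat.pair j i) = Part.some (Encodable.encode o)) :
    ∃ s, ∀ r, listing c j (Nat.pair r i) = if r = s then o else none := by
  obtain ⟨s, hs⟩ := exists_halting_time h
  refine ⟨s, fun r => ?_⟩
  simp only [listing, Nat.unpair_pair, hs]
  rcases lt_trichotomy r s with hr | rfl | hr
  · simp [hr.not_gt, hr.ne, show ¬ s < r + 1 by omega]
  · simp
  · simp [hr, hr.ne']

theorem tsum_weight_listing {c : Nat.Partrec.Code} {j : ℕ} {f : ℕ → Option (List Bool)}
    (h : ∀ i, c.eval (Nat.pair j i) = Part.some (Encodable.encode (f i))) :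
    ∑' t, weight (listing c j t) = ∑' i, weight (f i) := by
  rw [tsum_pair, ENNReal.tsum_comm]
  refine tsum_congr fun i => ?_
  obtain ⟨s, hs⟩ := exists_listing_eq (h i)
  rw [tsum_eq_single s fun r hr => by simp [hs, hr, weight]]
  simp [hs]

theorem exists_universal_eq {g : ℕ → ℕ → Option (List Bool)} (hg : Computable₂ g)
    (hw : ∀ k, ∑' n, weight (g k n) ≤ ((2 : ℝ≥0∞) ^ k)⁻¹) (k : ℕ) :
    ∃ j, ∀ i, ∃ n, universal k n = g j i := by
  obtain ⟨c, hc⟩ := exists_code_of_computable₂ hg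
  set e := Encodable.encode c with he
  refine ⟨k + e + 1, fun i => ?_⟩
  obtain ⟨s, hs⟩ := exists_listing_eq (hc (k + e + 1) i)
  refine ⟨Nat.pair e (Nat.pair s i), ?_⟩
  have hsum : ∑' t, weight (listing c (k + e + 1) t) ≤ ((2 : ℝ≥0∞) ^ (k + e + 1))⁻¹ :=
    (tsum_weight_listing (hc (k + e + 1))).trans_le (hw _)
  simp only [universal, Nat.unpair_pair]
  rw [show Denumerable.ofNat Nat.Partrec.Code e = c from Denumerable.ofNat_encode c,
    truncate_eq_self hsum, hs, if_pos rfl]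

end EffNull

/-- **Martin-Löf's universal test theorem.** There is a largest effectively null subset
of Cantor space. -/
theorem exists_largest_effnull :
    ∃ U : Set (ℕ → Bool), EffNull U ∧ ∀ X : Set (ℕ → Bool), EffNull X → X ⊆ U := by
  refine ⟨⋂ k, ⋃ n, ⋃ w ∈ EffNull.universal k n, cyl w,
    ⟨EffNull.universal, EffNull.primrec₂_universal.to_comp,
      fun k => ⟨iInter_subset _ k, EffNull.tsum_weight_universal_le k⟩⟩, ?_⟩
  rintro X ⟨g, hg, hX⟩ ω hω
  refine mem_iInter.2 fun k => ?_
  obtain ⟨j, hj⟩ := EffNull.exists_universal_eq hg (fun k => (hX k).2) k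
  have hcov := (hX j).1 hω
  simp only [mem_iUnion] at hcov ⊢
  obtain ⟨i, w, hw, hmem⟩ := hcov
  obtain ⟨n, hn⟩ := hj i
  exact ⟨n, w, hn ▸ hw, hmem⟩
end

section
/- Schnorr's separation theorem: there exists a sequence ω : ℕ → Bool that is not Martin-Löf random but such that no computable martingale wins against ω. -/
open Filter MeasureTheory Set
open scoped ENNReal

lemma encode_rat (q : ℚ) :
    @Encodable.encode ℚ Rat.instEncodable q = Nat.pair (Equiv.intEquivNat q.num) q.den := by
  rfl

/-- The numerals coding rationals. -/
def IsRatCode (y : ℕ) : Prop :=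
  0 < y.unpair.2 ∧ Nat.Coprime ((y.unpair.1 + 1) / 2) y.unpair.2

lemma natAbs_eq_intEquivNat (z : ℤ) : z.natAbs = (Equiv.intEquivNat z + 1) / 2 := by
  rcases z with n | n
  · change n = (2 * n + 1) / 2
    lia
  · change n + 1 = (2 * n + 1 + 1) / 2
    lia

lemma mem_range_encode_rat (y : ℕ) :
    y ∈ Set.range (@Encodable.encode ℚ Rat.instEncodable) ↔ IsRatCode y := by
  constructor
  · rintro ⟨q, rfl⟩
    rw [encode_rat, IsRatCode, Nat.unpair_pair]
    dsimp only
    rw [← natAbs_eq_intEquivNat]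
    exact ⟨q.den_pos, q.reduced⟩
  · rintro ⟨h0, h1⟩
    refine ⟨⟨Equiv.intEquivNat.symm y.unpair.1, y.unpair.2, h0.ne', ?_⟩, ?_⟩
    · rwa [natAbs_eq_intEquivNat, Equiv.apply_symm_apply]
    · rw [encode_rat]
      simp

lemma primrecPred_isRatCode : PrimrecPred IsRatCode := by
  have hden : Primrec fun y : ℕ => y.unpair.2 := Primrec.snd.comp Primrec.unpair
  have hnum : Primrec fun y : ℕ => (y.unpair.1 + 1) / 2 :=
    Primrec.nat_div.comp (Primrec.succ.comp (Primrec.fst.comp Primrec.unpair)) (Primrec.const 2)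
  have hdvd : PrimrecRel fun d y : ℕ =>
      ¬ (((y.unpair.1 + 1) / 2) % d = 0 ∧ y.unpair.2 % d = 0) ∨ d = 1 := by
    refine PrimrecPred.or (PrimrecPred.not (PrimrecPred.and ?_ ?_)) ?_
    · exact Primrec.eq.comp (Primrec.nat_mod.comp (hnum.comp Primrec.snd) Primrec.fst)
        (Primrec.const 0)
    · exact Primrec.eq.comp (Primrec.nat_mod.comp (hden.comp Primrec.snd) Primrec.fst)
        (Primrec.const 0)
    · exact Primrec.eq.comp Primrec.fst (Primrec.const 1)
  have hall := hdvd.forall_lt.comp (Primrec.succ.comp hden) Primrec.id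
  refine ((Primrec.nat_lt.comp (Primrec.const 0) hden).and hall).of_eq fun y => ?_
  refine and_congr_right fun h0 => ?_
  constructor
  · intro h
    have := h (Nat.gcd ((y.unpair.1 + 1) / 2) y.unpair.2)
      (Nat.lt_succ_of_le (Nat.gcd_le_right _ h0))
    exact this.resolve_left (not_not.2 ⟨Nat.mod_eq_zero_of_dvd (Nat.gcd_dvd_left _ _),
      Nat.mod_eq_zero_of_dvd (Nat.gcd_dvd_right _ _)⟩)
  · intro h d _
    refine or_iff_not_imp_left.2 fun hd => ?_
    rw [not_not] at hd
    exact Nat.eq_one_of_dvd_coprimes h (Nat.dvd_of_mod_eq_zero hd.1) (Nat.dvd_of_mod_eq_zero hd.2)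

lemma computable_nat_find {α : Type*} [Primcodable α] {p : α → ℕ → Prop}
    [∀ a, DecidablePred (p a)] (hp : Computable₂ fun a n => decide (p a n))
    (h : ∀ a, ∃ n, p a n) : Computable fun a => Nat.find (h a) := by
  refine Partrec.of_eq_tot (Partrec.rfind hp.partrec₂) fun a => ?_
  rw [Nat.mem_rfind]
  refine ⟨?_, fun hm => ?_⟩
  · simpa using Nat.find_spec (h a)
  · simpa using Nat.find_min (h a) hm

lemma computable_subtype_ofNat (s : Set ℕ) [DecidablePred (· ∈ s)] [Infinite s]
    (hs : Computable fun n => decide (n ∈ s)) :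
    Computable fun n => (Nat.Subtype.ofNat s n : ℕ) := by
  have hinf : s.Infinite := Set.infinite_coe_iff.1 inferInstance
  have hex : ∀ x : ℕ, ∃ m, x + m + 1 ∈ s := fun x => by
    obtain ⟨y, hy, hxy⟩ := hinf.exists_gt x
    exact ⟨y - x - 1, by rwa [show x + (y - x - 1) + 1 = y by lia]⟩
  have hstep : Computable fun x => Nat.find (hex x) := by
    refine computable_nat_find (p := fun x m => x + m + 1 ∈ s) ?_ hex
    have hadd : Computable fun p : ℕ × ℕ => p.1 + p.2 + 1 :=
      Computable.succ.comp (Primrec.nat_add.to_comp.comp Computable.fst Computable.snd)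
    exact hs.comp hadd
  have hrec : Computable fun n : ℕ => Nat.rec (motive := fun _ => ℕ) (Nat.Subtype.ofNat s 0 : ℕ)
      (fun _ x => x + Nat.find (hex x) + 1) n := by
    refine Computable.nat_rec (h := fun _ p => p.2 + Nat.find (hex p.2) + 1) Computable.id
      (Computable.const _) ?_
    have hx : Computable fun p : ℕ × ℕ × ℕ => p.2.2 := Computable.snd.comp Computable.snd
    have hadd : Computable fun p : ℕ × ℕ × ℕ => p.2.2 + Nat.find (hex p.2.2) + 1 :=
      Computable.succ.comp (Primrec.nat_add.to_comp.comp hx (hstep.comp hx))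
    exact hadd
  refine hrec.of_eq fun n => ?_
  induction n with
  | zero => rfl
  | succ n ih =>
    change _ + Nat.find (hex _) + 1 = (Nat.Subtype.ofNat s n : ℕ) + Nat.find (hex _) + 1
    rw [ih]

lemma computable_rat_encode :
    Computable fun q : ℚ => @Encodable.encode ℚ Rat.instEncodable q := by
  let : DecidablePred (· ∈ Set.range (@Encodable.encode ℚ Rat.instEncodable)) :=
    @Encodable.decidableRangeEncode ℚ Rat.instEncodable
  have : Infinite (Set.range (@Encodable.encode ℚ Rat.instEncodable)) :=
    Infinite.of_injective _ (Equiv.ofInjective _ Encodable.encode_injective).injective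
  have key := computable_subtype_ofNat (Set.range (@Encodable.encode ℚ Rat.instEncodable)) (by
    obtain ⟨_, h⟩ := primrecPred_isRatCode
    refine h.to_comp.of_eq fun n => ?_
    exact decide_eq_decide.2 (mem_range_encode_rat n).symm)
  have henc : Computable fun q : ℚ => Denumerable.eqv ℚ q := by
    exact Computable.encode (α := ℚ)
  refine (key.comp henc).of_eq fun q => ?_
  have : (Denumerable.eqv ℚ).symm (Denumerable.eqv ℚ q) = q := Equiv.symm_apply_apply _ _
  conv_rhs => rw [← this]
  generalize Denumerable.eqv ℚ q = n
  change _ = @Encodable.encode ℚ Rat.instEncodable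
    ((@Encodable.equivRangeEncode ℚ Rat.instEncodable).symm (Nat.Subtype.ofNat _ n))
  have h2 := (@Encodable.equivRangeEncode ℚ Rat.instEncodable).apply_symm_apply
    (Nat.Subtype.ofNat _ n)
  exact (congrArg Subtype.val h2).symm

lemma computable_rat_num_natAbs : Computable fun q : ℚ => q.num.natAbs := by
  refine (Primrec.nat_div.to_comp.comp (Computable.succ.comp (Computable.fst.comp
    (Computable.unpair.comp computable_rat_encode))) (Computable.const 2)).of_eq fun q => ?_
  rw [encode_rat, Nat.unpair_pair, natAbs_eq_intEquivNat]

lemma computable_rat_den : Computable fun q : ℚ => q.den := by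
  refine (Computable.snd.comp (Computable.unpair.comp computable_rat_encode)).of_eq fun q => ?_
  rw [encode_rat, Nat.unpair_pair]

/-- `m` is approximable when some computable family of naturals `B x s` approximates
`2 ^ s * m x` with a uniformly bounded error. -/
def Approximable (m : List Bool → ℝ) : Prop :=
  ∃ B : List Bool → ℕ → ℕ, Computable₂ B ∧
    ∃ C : ℝ, ∀ x s, |(B x s : ℝ) - 2 ^ s * m x| ≤ C

lemma abs_natDiv_sub_div_le (a b : ℕ) : |((a / b : ℕ) : ℝ) - (a : ℝ) / b| ≤ 1 := by
  rw [← Nat.floor_div_eq_div (K := ℝ), abs_sub_comm, abs_le]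
  have h1 := Nat.floor_le (show (0 : ℝ) ≤ (a : ℝ) / b by positivity)
  have h2 := Nat.lt_floor_add_one ((a : ℝ) / b)
  constructor <;> linarith

lemma computable_two_pow : Computable fun s : ℕ => 2 ^ s := by
  refine (Computable.nat_rec (f := fun s : ℕ => s) (g := fun _ => 1)
    (h := fun _ p => 2 * p.2) Computable.id (Computable.const 1) ?_).of_eq fun s => ?_
  · have h : Computable fun q : ℕ × ℕ × ℕ => 2 * q.2.2 :=
      Primrec.nat_mul.to_comp.comp (Computable.const 2) (Computable.snd.comp Computable.snd)
    exact h
  · induction s with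
    | zero => rfl
    | succ n ih => rw [pow_succ', ← ih]

lemma approximable_zero : Approximable fun _ => 0 :=
  ⟨fun _ _ => 0, Computable.const 0, 0, by simp⟩

lemma Approximable.add {m m' : List Bool → ℝ} (h : Approximable m) (h' : Approximable m') :
    Approximable fun x => m x + m' x := by
  obtain ⟨B, hB, C, hC⟩ := h
  obtain ⟨B', hB', C', hC'⟩ := h'
  refine ⟨fun x s => B x s + B' x s, ?_, C + C', fun x s => ?_⟩
  · exact Primrec.nat_add.to_comp.comp₂ hB hB'
  · refine le_trans ?_ (add_le_add (hC x s) (hC' x s))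
    refine le_trans (le_of_eq ?_) (abs_add_le _ _)
    push_cast
    ring_nf

lemma Approximable.div_nat {m : List Bool → ℝ} (h : Approximable m) {N : ℕ} (hN : 0 < N) :
    Approximable fun x => m x / N := by
  obtain ⟨B, hB, C, hC⟩ := h
  refine ⟨fun x s => B x s / N, ?_, 1 + C, fun x s => ?_⟩
  · exact Primrec.nat_div.to_comp.comp₂ hB (Computable.const N)
  · have hN1 : (1 : ℝ) ≤ N := by exact_mod_cast hN
    have h2 : |(B x s : ℝ) / N - 2 ^ s * (m x / N)| ≤ C := by
      rw [← mul_div_assoc, ← sub_div, abs_div, Nat.abs_cast]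
      exact (div_le_self (abs_nonneg _) hN1).trans (hC x s)
    exact (abs_sub_le _ _ _).trans (add_le_add (abs_natDiv_sub_div_le _ _) h2)

lemma ComputableFn.approximable {m : List Bool → ℝ} (h : ComputableFn m) (h0 : ∀ x, 0 ≤ m x) :
    Approximable m := by
  obtain ⟨g, hg, hgm⟩ := h
  refine ⟨fun x s => (g x s).num.natAbs * 2 ^ s / (g x s).den, ?_, 2, fun x s => ?_⟩
  · refine Primrec.nat_div.to_comp.comp₂ (Primrec.nat_mul.to_comp.comp₂ ?_ ?_) ?_
    · exact computable_rat_num_natAbs.comp hg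
    · exact computable_two_pow.comp Computable.snd
    · exact computable_rat_den.comp hg
  · have h1 := abs_natDiv_sub_div_le ((g x s).num.natAbs * 2 ^ s) (g x s).den
    have h2 : (((g x s).num.natAbs * 2 ^ s : ℕ) : ℝ) / (g x s).den = 2 ^ s * |(g x s : ℝ)| := by
      conv_rhs => rw [Rat.cast_def, abs_div, Nat.abs_cast]
      push_cast
      rw [Nat.cast_natAbs]
      push_cast
      ring
    have h3 : |2 ^ s * |(g x s : ℝ)| - 2 ^ s * m x| ≤ 1 := by
      rw [← mul_sub, abs_mul, abs_of_pos (by positivity : (0 : ℝ) < 2 ^ s)]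
      have h4 : |(|(g x s : ℝ)|) - m x| ≤ 2 ^ (-(s : ℤ)) := by
        conv_lhs => rw [← abs_of_nonneg (h0 x)]
        exact (abs_abs_sub_abs_le _ _).trans (hgm x s)
      calc (2 : ℝ) ^ s * |(|(g x s : ℝ)|) - m x| ≤ 2 ^ s * 2 ^ (-(s : ℤ)) := by gcongr
        _ = 1 := by
          rw [zpow_neg, zpow_natCast]
          exact mul_inv_cancel₀ (by positivity)
    rw [h2] at h1
    refine (abs_sub_le _ _ _).trans ((add_le_add h1 h3).trans ?_)
    norm_num

lemma exists_computable_path {M : List Bool → ℝ} (hM : IsMartingale M) (hA : Approximable M)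
    (w : List Bool) {ε : ℝ} (hε : 0 < ε) :
    ∃ f : ℕ → List Bool, Computable f ∧ f 0 = w ∧ (∀ n, ∃ b, f (n + 1) = f n ++ [b]) ∧
      ∀ n, M (f n) ≤ M w + ε := by
  obtain ⟨B, hB, C, hC⟩ := hA
  have hC0 : 0 ≤ C := (abs_nonneg _).trans (hC [] 0)
  obtain ⟨s, hs⟩ : ∃ s : ℕ, 2 * C < ε * 2 ^ s := by
    obtain ⟨s, hs⟩ := pow_unbounded_of_one_lt (2 * C / ε) (one_lt_two (α := ℝ))
    exact ⟨s, by rwa [div_lt_iff₀' hε] at hs⟩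
  let bit : List Bool → Bool := fun x =>
    decide (B (x ++ [true]) (x.length + 1 + s) < B (x ++ [false]) (x.length + 1 + s))
  let f : ℕ → List Bool := fun n =>
    Nat.rec (motive := fun _ => List Bool) w (fun _ x => x ++ [bit x]) n
  have hfsucc : ∀ n, f (n + 1) = f n ++ [bit (f n)] := fun n => rfl
  have hbit : Computable bit := by
    have hlen : Computable fun x : List Bool => x.length + 1 + s :=
      Primrec.nat_add.to_comp.comp (Computable.succ.comp Computable.list_length)
        (Computable.const s)
    have hval : ∀ b : Bool, Computable fun x : List Bool => B (x ++ [b]) (x.length + 1 + s) :=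
      fun b => hB.comp (Computable.list_concat.comp Computable.id (Computable.const b)) hlen
    exact (Primrec.nat_lt.decide).to_comp.comp (hval true) (hval false)
  refine ⟨f, ?_, rfl, fun n => ⟨_, hfsucc n⟩, fun n => ?_⟩
  · refine Computable.nat_rec (h := fun _ p => p.2 ++ [bit p.2]) Computable.id
      (Computable.const w) ?_
    have hx : Computable fun p : ℕ × ℕ × List Bool => p.2.2 := Computable.snd.comp Computable.snd
    exact Computable.list_concat.comp hx (hbit.comp hx)
  · let V : List Bool → ℝ := fun x => M x + 2 * C / 2 ^ (x.length + s)
    have hV : ∀ x, V (x ++ [bit x]) ≤ V x := fun x => by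
      have ht := abs_le.1 (hC (x ++ [true]) (x.length + 1 + s))
      have hf := abs_le.1 (hC (x ++ [false]) (x.length + 1 + s))
      have hm := hM.2 x
      have hlt : 2 ^ (x.length + 1 + s) * M (x ++ [bit x]) ≤
          2 ^ (x.length + 1 + s) * M x + 2 * C := by
        by_cases hb : B (x ++ [true]) (x.length + 1 + s) < B (x ++ [false]) (x.length + 1 + s)
        · rw [show bit x = true from decide_eq_true hb, hm]
          have : (B (x ++ [true]) (x.length + 1 + s) : ℝ) < B (x ++ [false]) (x.length + 1 + s) :=
            by exact_mod_cast hb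
          linarith
        · rw [show bit x = false from decide_eq_false hb, hm]
          have : (B (x ++ [false]) (x.length + 1 + s) : ℝ) ≤ B (x ++ [true]) (x.length + 1 + s) :=
            by exact_mod_cast not_lt.1 hb
          linarith
      have hp : (0 : ℝ) < 2 ^ (x.length + s) := by positivity
      have he : (2 : ℝ) ^ (x.length + 1 + s) = 2 * 2 ^ (x.length + s) := by ring
      simp only [V, List.length_append, List.length_singleton]
      rw [he] at hlt ⊢
      have h3 : M (x ++ [bit x]) ≤ M x + C / 2 ^ (x.length + s) := by
        rw [← sub_le_iff_le_add', le_div_iff₀ hp]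
        linarith
      have h4 : 2 * C / (2 * 2 ^ (x.length + s)) = C / 2 ^ (x.length + s) := by
        field_simp
      have h5 : 2 * C / 2 ^ (x.length + s) = 2 * (C / 2 ^ (x.length + s)) := by ring
      rw [h4, h5]
      linarith
    have hVn : V (f n) ≤ V w := by
      induction n with
      | zero => exact le_rfl
      | succ n ih => exact (hV (f n)).trans ih
    have h1 : M (f n) ≤ V (f n) := le_add_of_nonneg_right (by positivity)
    have h2 : V w ≤ M w + ε := by
      refine add_le_add le_rfl ?_
      rw [div_le_iff₀ (by positivity)]
      refine hs.le.trans (mul_le_mul_of_nonneg_left ?_ hε.le)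
      exact pow_le_pow_right₀ one_le_two (Nat.le_add_left _ _)
    exact h1.trans (hVn.trans h2)

lemma IsMartingale.add_div_nat {M m : List Bool → ℝ} (hM : IsMartingale M) (hm : IsMartingale m)
    (N : ℕ) : IsMartingale fun x => M x + m x / N := by
  refine ⟨fun x => add_nonneg (hM.1 x) (div_nonneg (hm.1 x) N.cast_nonneg), fun x => ?_⟩
  linear_combination hM.2 x + hm.2 x / N

lemma countable_computableFn : {m : List Bool → ℝ | ComputableFn m}.Countable := by
  rw [← Set.countable_coe_iff]
  choose g hg hgm using fun m : {m : List Bool → ℝ | ComputableFn m} => m.2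
  let F : {m : List Bool → ℝ | ComputableFn m} → {f : ℕ → ℕ // Computable f} := fun m =>
    ⟨fun n => Denumerable.eqv ℚ
      (g m ((Encodable.decode (α := List Bool) n.unpair.1).getD []) n.unpair.2),
      (Computable.encode (α := ℚ)).comp ((hg m).comp
        (Computable.option_getD (Computable.decode.comp (Computable.fst.comp Computable.unpair))
          (Computable.const [])) (Computable.snd.comp Computable.unpair))⟩
  refine Function.Injective.countable (f := F) fun m m' h => Subtype.ext (funext fun x => ?_)
  have hgg : ∀ n, g m x n = g m' x n := fun n => by
    have := congrFun (congrArg Subtype.val h) (Nat.pair (Encodable.encode x) n)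
    simpa [F] using this
  have hlim : ∀ m : {m : List Bool → ℝ | ComputableFn m},
      Tendsto (fun n => (g m x n : ℝ)) atTop (nhds (m.1 x)) := fun m => by
    rw [tendsto_iff_dist_tendsto_zero]
    refine squeeze_zero (fun _ => dist_nonneg) (fun n => hgm m x n) ?_
    simp_rw [zpow_neg, zpow_natCast, ← inv_pow]
    exact tendsto_pow_atTop_nhds_zero_of_lt_one (by norm_num) (by norm_num)
  refine tendsto_nhds_unique (hlim m) ?_
  simp_rw [hgg]
  exact hlim m'

lemma prefixFn_isPrefix_of_le (ω : ℕ → Bool) {a b : ℕ} (h : a ≤ b) :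
    prefixFn ω a <+: prefixFn ω b := by
  rw [List.prefix_iff_eq_take]
  refine List.ext_getElem ?_ fun i h1 h2 => ?_
  · simp [prefixFn, h]
  · simp [prefixFn]

@[simp]
lemma length_prefixFn (ω : ℕ → Bool) (n : ℕ) : (prefixFn ω n).length = n := by
  simp [prefixFn]

lemma exists_limit_of_prefix_chain {u : ℕ → List Bool} (h : ∀ n, u n <+: u (n + 1))
    (hlen : ∀ n, n ≤ (u n).length) : ∃ ω : ℕ → Bool, ∀ n, prefixFn ω (u n).length = u n := by
  have hmono : ∀ {a b}, a ≤ b → u a <+: u b := fun {a b} hab => by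
    induction hab with
    | refl => exact List.prefix_rfl
    | step _ ih => exact ih.trans (h _)
  refine ⟨fun i => (u (i + 1))[i]'(hlen (i + 1)), fun n => ?_⟩
  refine List.ext_getElem (by simp) fun i h1 h2 => ?_
  simp only [prefixFn, List.getElem_ofFn]
  rcases le_total n (i + 1) with hn | hn
  · exact ((hmono hn).getElem h2).symm
  · exact (hmono hn).getElem _

open Nat.Partrec (Code)

/-- Every string output by the code `c` on input `encode c + k + 1`, provided that it has at
least that length, enumerated at the first stage at which the computation halts. -/
def universalTest (k n : ℕ) : Option (List Bool) :=
  if (Code.evaln n.unpair.2 (Denumerable.ofNat Code n.unpair.1) (n.unpair.1 + k + 1)).isSome then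
    none
  else
    (Code.evaln (n.unpair.2 + 1) (Denumerable.ofNat Code n.unpair.1) (n.unpair.1 + k + 1)).bind
      fun v => (Encodable.decode v : Option (List Bool)).bind
        fun w => if n.unpair.1 + k + 1 ≤ w.length then some w else none

lemma computable₂_universalTest : Computable₂ universalTest := by
  have hin : Primrec fun p : ℕ × ℕ => p.2.unpair.1 + p.1 + 1 :=
    Primrec.succ.comp (Primrec.nat_add.comp
      (Primrec.fst.comp (Primrec.unpair.comp Primrec.snd)) Primrec.fst)
  have hc : Primrec fun p : ℕ × ℕ => Denumerable.ofNat Code p.2.unpair.1 :=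
    (Primrec.ofNat Code).comp (Primrec.fst.comp (Primrec.unpair.comp Primrec.snd))
  have ht : Primrec fun p : ℕ × ℕ => p.2.unpair.2 :=
    Primrec.snd.comp (Primrec.unpair.comp Primrec.snd)
  have hev : Primrec fun p : ℕ × ℕ => Code.evaln p.2.unpair.2
      (Denumerable.ofNat Code p.2.unpair.1) (p.2.unpair.1 + p.1 + 1) :=
    Code.primrec_evaln.comp (Primrec.pair (Primrec.pair ht hc) hin)
  have hev' : Primrec fun p : ℕ × ℕ => Code.evaln (p.2.unpair.2 + 1)
      (Denumerable.ofNat Code p.2.unpair.1) (p.2.unpair.1 + p.1 + 1) :=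
    Code.primrec_evaln.comp (Primrec.pair (Primrec.pair (Primrec.succ.comp ht) hc) hin)
  have hprim : Primrec fun p : ℕ × ℕ => universalTest p.1 p.2 := by
    refine Primrec.ite (Primrec.eq.comp (Primrec.option_isSome.comp hev) (Primrec.const true))
      (Primrec.const none) (Primrec.option_bind hev' ?_)
    refine Primrec.option_bind (Primrec.decode.comp Primrec.snd) ?_
    refine Primrec.ite (Primrec.nat_le.comp ?_ ?_) ?_ (Primrec.const none)
    · exact hin.comp (Primrec.fst.comp Primrec.fst)
    · exact Primrec.list_length.comp Primrec.snd
    · exact Primrec.option_some.comp Primrec.snd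
  exact hprim.to_comp

lemma universalTest_eq_some {k a t : ℕ} {w : List Bool}
    (h : universalTest k (Nat.pair a t) = some w) :
    ¬ (Code.evaln t (Denumerable.ofNat Code a) (a + k + 1)).isSome ∧
      (Code.evaln (t + 1) (Denumerable.ofNat Code a) (a + k + 1)).isSome ∧
      a + k + 1 ≤ w.length := by
  simp only [universalTest, Nat.unpair_pair] at h
  split_ifs at h with h0
  obtain ⟨v, hv, h⟩ := Option.bind_eq_some_iff.1 h
  obtain ⟨w', -, h⟩ := Option.bind_eq_some_iff.1 h
  split_ifs at h with h1
  obtain rfl := Option.some.inj h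
  exact ⟨h0, by rw [hv]; rfl, h1⟩

lemma tsum_universalTest_row_le (k a : ℕ) :
    (∑' t : ℕ, ((universalTest k (Nat.pair a t)).elim 0
      fun w => ((2 : ℝ≥0∞) ^ w.length)⁻¹)) ≤ ((2 : ℝ≥0∞) ^ (a + k + 1))⁻¹ := by
  by_cases hex : ∃ t w, universalTest k (Nat.pair a t) = some w
  · obtain ⟨t, w, hw⟩ := hex
    rw [tsum_eq_single t]
    · rw [hw]
      exact ENNReal.inv_le_inv.2 (pow_le_pow_right₀ one_le_two (universalTest_eq_some hw).2.2)
    · intro t' ht'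
      rcases hw' : universalTest k (Nat.pair a t') with _ | w'
      · rfl
      · exfalso
        have hmono : ∀ {s s' : ℕ}, s < s' →
            (Code.evaln (s + 1) (Denumerable.ofNat Code a) (a + k + 1)).isSome →
            (Code.evaln s' (Denumerable.ofNat Code a) (a + k + 1)).isSome := fun hs h => by
          obtain ⟨v, hv⟩ := Option.isSome_iff_exists.1 h
          exact Option.isSome_iff_exists.2 ⟨v, Code.evaln_mono hs hv⟩
        have h1 := universalTest_eq_some hw
        have h2 := universalTest_eq_some hw'
        rcases lt_or_gt_of_ne ht' with hlt | hlt
        · exact h1.1 (hmono hlt h2.2.1)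
        · exact h2.1 (hmono hlt h1.2.1)
  · push Not at hex
    have hnone : ∀ t, universalTest k (Nat.pair a t) = none :=
      fun t => Option.eq_none_iff_forall_ne_some.2 (hex t)
    simp [hnone]

lemma tsum_universalTest_le (k : ℕ) :
    (∑' n : ℕ, ((universalTest k n).elim 0 fun w => ((2 : ℝ≥0∞) ^ w.length)⁻¹)) ≤
      ((2 : ℝ≥0∞) ^ k)⁻¹ := by
  rw [← Nat.pairEquiv.tsum_eq, ENNReal.tsum_prod']
  refine (ENNReal.tsum_le_tsum fun a => tsum_universalTest_row_le k a).trans (le_of_eq ?_)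
  have hterm : ∀ a : ℕ, ((2 : ℝ≥0∞) ^ (a + k + 1))⁻¹ = (2⁻¹) ^ (a + 1) * (2 ^ k)⁻¹ := fun a => by
    rw [ENNReal.inv_pow, ENNReal.inv_pow, ← pow_add]
    congr 1
    ring
  simp_rw [hterm]
  rw [ENNReal.tsum_mul_right, ENNReal.tsum_geometric_add_one, ENNReal.one_sub_inv_two, inv_inv,
    ENNReal.inv_mul_cancel (by simp) (by simp), one_mul]

lemma exists_universalTest_eq {k : ℕ} {c : Code} {w : List Bool}
    (hw : Encodable.encode w ∈ c.eval (Encodable.encode c + k + 1))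
    (hlen : Encodable.encode c + k + 1 ≤ w.length) : ∃ n, universalTest k n = some w := by
  classical
  have hex := Code.evaln_complete.1 hw
  obtain ⟨t, ht⟩ : ∃ t, Nat.find hex = t + 1 := by
    refine Nat.exists_eq_succ_of_ne_zero fun h0 => ?_
    have h1 := Nat.find_spec hex
    rw [h0] at h1
    exact absurd (Code.evaln_bound h1) (Nat.not_lt_zero _)
  have hsome := Nat.find_spec hex
  rw [ht] at hsome
  refine ⟨Nat.pair (Encodable.encode c) t, ?_⟩
  simp only [universalTest, Nat.unpair_pair, Denumerable.ofNat_encode]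
  rw [if_neg, Option.mem_def.1 hsome]
  · simpa using Nat.lt_of_succ_le hlen
  · intro h
    obtain ⟨v, hv⟩ := Option.isSome_iff_exists.1 h
    have hv' : v = Encodable.encode w := Part.mem_unique (Code.evaln_sound hv) hw
    exact Nat.find_min hex (ht ▸ Nat.lt_succ_self t) (hv' ▸ hv)

lemma not_mlRandom_of_code_prefixes {ω : ℕ → Bool}
    (h : ∀ k, ∃ c : Code, ∃ w : List Bool,
      Encodable.encode w ∈ c.eval (Encodable.encode c + k + 1) ∧
        Encodable.encode c + k + 1 ≤ w.length ∧ prefixFn ω w.length = w) : ¬ MLRandom ω := by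
  intro hω
  refine hω {ω} ⟨universalTest, computable₂_universalTest, fun k => ⟨?_, tsum_universalTest_le k⟩⟩
    rfl
  obtain ⟨c, w, hw, hlen, hpre⟩ := h k
  obtain ⟨n, hn⟩ := exists_universalTest_eq hw hlen
  rw [Set.singleton_subset_iff]
  exact Set.mem_iUnion.2 ⟨n, Set.mem_iUnion₂.2 ⟨w, hn, hpre⟩⟩

/-- The invariant of the construction: a finite string and a computably approximable martingale
which has not reached `2` on that string. -/
def IsStage (s : List Bool × (List Bool → ℝ)) : Prop :=
  IsMartingale s.2 ∧ Approximable s.2 ∧ s.2 s.1 < 2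

/-- One step of the construction: the string is extended along a computable sequence on which the
current martingale stays below `2`, then a small multiple of `m` is added to the martingale. -/
def IsStep (m : List Bool → ℝ) (k : ℕ) (s s' : List Bool × (List Bool → ℝ)) : Prop :=
  s.1 <+: s'.1 ∧ s.1.length < s'.1.length ∧
    (∀ w, s.1 <+: w → w <+: s'.1 → s.2 w < 2) ∧
    (∃ N : ℕ, 0 < N ∧ ∀ x, s'.2 x = s.2 x + m x / N) ∧
    ∃ c : Code, Encodable.encode s'.1 ∈ c.eval (Encodable.encode c + k + 1) ∧
      Encodable.encode c + k + 1 ≤ s'.1.length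

lemma exists_isStep {m : List Bool → ℝ} (hm : IsMartingale m) (hA : Approximable m) (k : ℕ)
    {s : List Bool × (List Bool → ℝ)} (hs : IsStage s) : ∃ s', IsStage s' ∧ IsStep m k s s' := by
  obtain ⟨w, M⟩ := s
  obtain ⟨hM, hMA, hw⟩ := hs
  dsimp only at hM hMA hw
  obtain ⟨f, hf, hf0, hfs, hfM⟩ :=
    exists_computable_path hM hMA w (half_pos (sub_pos.2 hw))
  have hlt : ∀ n, M (f n) < 2 := fun n => by linarith [hfM n]
  have hlen : ∀ n, (f n).length = w.length + n := fun n => by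
    induction n with
    | zero => rw [hf0, add_zero]
    | succ n ih =>
      obtain ⟨b, hb⟩ := hfs n
      rw [hb, List.length_append, ih, List.length_singleton, add_assoc]
  have hmono : ∀ {a b}, a ≤ b → f a <+: f b := fun {a b} hab => by
    induction hab with
    | refl => exact List.prefix_rfl
    | @step n _ ih =>
      obtain ⟨b, hb⟩ := hfs n
      exact ih.trans (hb ▸ List.prefix_append _ _)
  obtain ⟨c, hc⟩ := Code.exists_code.1
    (Partrec.nat_iff.1 (Computable.encode.comp hf).partrec)
  set L := Encodable.encode c + k + 1 with hL
  obtain ⟨N, hN⟩ := exists_nat_gt (m (f L) / (2 - M (f L)))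
  have hpos : 0 < 2 - M (f L) := sub_pos.2 (hlt L)
  have hN0 : (0 : ℝ) < N := (div_nonneg (hm.1 _) hpos.le).trans_lt hN
  have hN0' : 0 < N := by exact_mod_cast hN0
  refine ⟨(f L, fun x => M x + m x / N), ⟨hM.add_div_nat hm N, hMA.add (hA.div_nat hN0'), ?_⟩,
    ?_, ?_, ?_, ⟨N, hN0', fun _ => rfl⟩, c, ?_, ?_⟩
  · rw [div_lt_iff₀ hpos] at hN
    have : m (f L) / N < 2 - M (f L) := by rwa [div_lt_iff₀' hN0]
    dsimp only
    linarith
  · exact hf0 ▸ hmono (Nat.zero_le L)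
  · dsimp only
    rw [hlen]
    lia
  · intro v hv hv'
    dsimp only at hv hv' ⊢
    have hvL : v.length ≤ w.length + L := hlen L ▸ hv'.length_le
    have hv1 := hv.length_le
    have hpre : f (v.length - w.length) <+: f L := hmono (by lia)
    have heq : v = f (v.length - w.length) :=
      (List.prefix_of_prefix_length_le hv' hpre (by rw [hlen]; lia)).eq_of_length
        (by rw [hlen]; lia)
    rw [heq]
    exact hlt _
  · rw [hc]
    exact Part.mem_some _
  · dsimp only
    rw [hlen]
    lia

lemma exists_stage_sequence {m : ℕ → List Bool → ℝ} (hm : ∀ k, IsMartingale (m k))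
    (hA : ∀ k, Approximable (m k)) : ∃ s : ℕ → List Bool × (List Bool → ℝ),
      ∀ k, IsStage (s k) ∧ IsStep (m k) k (s k) (s (k + 1)) := by
  choose next hstage hstep using fun k (s : {s // IsStage s}) =>
    exists_isStep (hm k) (hA k) k s.2
  let s : ℕ → {s // IsStage s} := fun n => Nat.rec
    ⟨([], fun _ => 0), ⟨fun _ => le_rfl, fun _ => by norm_num⟩, approximable_zero, two_pos⟩
    (fun k s => ⟨next k s, hstage k s⟩) n
  exact ⟨fun n => (s n).1, fun k => ⟨(s k).2, hstep k (s k)⟩⟩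

lemma not_wins_of_stage_sequence {m : ℕ → List Bool → ℝ} (hm : ∀ k, IsMartingale (m k))
    {s : ℕ → List Bool × (List Bool → ℝ)}
    (hs : ∀ k, IsStage (s k) ∧ IsStep (m k) k (s k) (s (k + 1)))
    {ω : ℕ → Bool} (hω : ∀ k, prefixFn ω (s k).1.length = (s k).1) (k : ℕ) :
    ¬ Wins (m k) ω := by
  obtain ⟨N, hN, hMN⟩ := (hs k).2.2.2.2.1
  have hN0 : (0 : ℝ) < N := by exact_mod_cast hN
  have hle : ∀ d x, m k x / N ≤ (s (k + 1 + d)).2 x := fun d x => by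
    induction d with
    | zero =>
      rw [add_zero, hMN]
      exact le_add_of_nonneg_left ((hs k).1.1.1 x)
    | succ d ih =>
      obtain ⟨N', -, hMN'⟩ := (hs (k + 1 + d)).2.2.2.2.1
      rw [← add_assoc, hMN']
      exact ih.trans (le_add_of_nonneg_right (div_nonneg ((hm _).1 x) N'.cast_nonneg))
  have hlt : ∀ d n, (s (k + 1)).1.length ≤ n → n ≤ (s (k + 1 + d)).1.length →
      m k (prefixFn ω n) < 2 * N := by
    intro d
    have hbound : ∀ d x, (s (k + 1 + d)).2 x < 2 → m k x < 2 * N := fun d x hx =>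
      (div_lt_iff₀ hN0).1 ((hle d x).trans_lt hx)
    induction d with
    | zero =>
      intro n h1 h2
      obtain rfl : n = (s (k + 1)).1.length := le_antisymm h2 h1
      rw [hω]
      exact hbound 0 _ (hs (k + 1)).1.2.2
    | succ d ih =>
      intro n h1 h2
      rcases le_total n (s (k + 1 + d)).1.length with h | h
      · exact ih n h1 h
      · refine hbound d _ ((hs (k + 1 + d)).2.2.2.1 _ ?_ ?_)
        · rw [← hω (k + 1 + d)]
          exact prefixFn_isPrefix_of_le ω h
        · rw [← hω (k + 1 + d + 1)]
          exact prefixFn_isPrefix_of_le ω h2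
  have hlen : ∀ j, j ≤ (s j).1.length := fun j => by
    induction j with
    | zero => exact Nat.zero_le _
    | succ j ih => exact ih.trans_lt (hs j).2.2.1
  intro hwin
  obtain ⟨n, hn⟩ := hwin
    (2 * N + ∑ i ∈ Finset.range (s (k + 1)).1.length, m k (prefixFn ω i))
  have hsum : 0 ≤ ∑ i ∈ Finset.range (s (k + 1)).1.length, m k (prefixFn ω i) :=
    Finset.sum_nonneg fun i _ => (hm k).1 _
  rcases lt_or_ge n (s (k + 1)).1.length with h | h
  · have := Finset.single_le_sum (f := fun i => m k (prefixFn ω i)) (fun i _ => (hm k).1 _)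
      (Finset.mem_range.2 h)
    linarith
  · have := hlt n n h ((Nat.le_add_left n (k + 1)).trans (hlen _))
    linarith

/-- **Schnorr's separation theorem.** There is a sequence that is not Martin-Löf random
but against which no computable martingale wins. -/
theorem schnorr_separation :
    ∃ ω : ℕ → Bool, ¬ MLRandom ω ∧
      ∀ m : List Bool → ℝ, IsMartingale m → ComputableFn m → ¬ Wins m ω := by
  obtain ⟨m, hm⟩ := (countable_computableFn.mono
    (Set.inter_subset_right (s := {m | IsMartingale m}))).exists_eq_range
    ⟨fun _ => 0, ⟨fun _ => le_rfl, fun _ => by norm_num⟩, fun _ _ => 0, Computable.const 0, by simp⟩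
  have hmem : ∀ k, IsMartingale (m k) ∧ ComputableFn (m k) := fun k =>
    (hm ▸ Set.mem_range_self k : m k ∈ {m | IsMartingale m} ∩ {m | ComputableFn m})
  obtain ⟨s, hs⟩ := exists_stage_sequence (fun k => (hmem k).1)
    fun k => (hmem k).2.approximable (hmem k).1.1
  have hlen : ∀ j, j ≤ (s j).1.length := fun j => by
    induction j with
    | zero => exact Nat.zero_le _
    | succ j ih => exact ih.trans_lt (hs j).2.2.1
  obtain ⟨ω, hω⟩ := exists_limit_of_prefix_chain (fun k => (hs k).2.1) hlen
  refine ⟨ω, not_mlRandom_of_code_prefixes fun k => ?_, fun m' hm' hc => ?_⟩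
  · obtain ⟨c, hc, hcl⟩ := (hs k).2.2.2.2.2
    exact ⟨c, (s (k + 1)).1, hc, hcl, hω (k + 1)⟩
  · have hmem' : m' ∈ Set.range m := hm ▸ ⟨hm', hc⟩
    obtain ⟨k, rfl⟩ := hmem'
    exact not_wins_of_stage_sequence (fun k => (hmem k).1) hs hω k
end

section
/- Schnorr's exponential-winning theorem: if a sequence ω : ℕ → Bool does not satisfy the strong law of large numbers (i.e., ω does not have limit frequency 1/2), then there exist a computable martingale m and a real c > 1 such that m [ω 0, …, ω (n−1)] ≥ c^n for infinitely many n. -/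
open Filter MeasureTheory Set
open scoped ENNReal

/-- The greatest common divisor of natural numbers is primitive recursive. -/
theorem primrec₂_gcd : Primrec₂ Nat.gcd := by
  have hdvd : PrimrecRel fun (p : ℕ × ℕ) (x : ℕ) => p.1 % x = 0 ∧ p.2 % x = 0 := by
    refine PrimrecPred.and ?_ ?_
    · exact Primrec.eq.comp (Primrec.nat_mod.comp (Primrec.fst.comp Primrec.fst) Primrec.snd)
        (Primrec.const 0)
    · exact Primrec.eq.comp (Primrec.nat_mod.comp (Primrec.snd.comp Primrec.fst) Primrec.snd)
        (Primrec.const 0)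
  have hbound : Primrec fun p : ℕ × ℕ => p.1 + p.2 :=
    Primrec.nat_add.comp Primrec.fst Primrec.snd
  refine (Primrec.nat_findGreatest hbound hdvd).of_eq fun p => ?_
  obtain ⟨a, b⟩ := p
  rw [Nat.findGreatest_eq_iff]
  refine ⟨?_, fun _ => ?_, fun n hn _ h => ?_⟩
  · rcases Nat.eq_zero_or_pos a with rfl | ha
    · simp
    · exact (Nat.gcd_le_left b ha).trans (Nat.le_add_right a b)
  · exact ⟨Nat.mod_eq_zero_of_dvd (Nat.gcd_dvd_left a b),
      Nat.mod_eq_zero_of_dvd (Nat.gcd_dvd_right a b)⟩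
  · have hdvd := Nat.dvd_gcd (Nat.dvd_of_mod_eq_zero h.1) (Nat.dvd_of_mod_eq_zero h.2)
    rcases Nat.eq_zero_or_pos (a.gcd b) with h0 | h0
    · obtain ⟨rfl, rfl⟩ := Nat.gcd_eq_zero_iff.1 h0
      simp_all
    · exact absurd (Nat.le_of_dvd h0 hdvd) (not_le.2 hn)

/-- Exponentiation of natural numbers is primitive recursive. -/
theorem primrec₂_pow : Primrec₂ fun a b : ℕ => a ^ b :=
  Primrec₂.unpaired'.1 Nat.Primrec.pow

/-- Counting the occurrences of a bit in a list is primitive recursive. -/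
theorem primrec_list_count (b : Bool) : Primrec fun x : List Bool => x.count b :=
  (Primrec.list_length.comp (Primrec.listFilter (p := fun c => c = b)
    (Primrec.eq.comp Primrec.id (Primrec.const b)))).of_eq fun x => by
      rw [List.count, List.countP_eq_length_filter]
      congr 2

theorem Int.encode_succ_div_two (z : ℤ) : (Encodable.encode z + 1) / 2 = z.natAbs := by
  cases z with
  | ofNat n =>
    change (2 * n + 1) / 2 = n
    omega
  | negSucc n =>
    change (2 * n + 1 + 1) / 2 = n + 1
    omega

theorem Rat.encode_eq_pair (q : ℚ) :
    @Encodable.encode ℚ Rat.instEncodable q = Nat.pair (Encodable.encode q.num) q.den := rfl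

/-- The range of the standard encoding of `ℚ`, described by a coprimality condition. -/
theorem Rat.mem_range_encode_iff (n : ℕ) :
    n ∈ Set.range (@Encodable.encode ℚ Rat.instEncodable) ↔
      0 < n.unpair.2 ∧ ((n.unpair.1 + 1) / 2).gcd n.unpair.2 = 1 := by
  constructor
  · rintro ⟨q, rfl⟩
    rw [Rat.encode_eq_pair, Nat.unpair_pair]
    exact ⟨q.pos, by rw [Int.encode_succ_div_two]; exact q.reduced⟩
  · rintro ⟨hpos, hcop⟩
    have hz : Encodable.encode (Denumerable.ofNat ℤ n.unpair.1) = n.unpair.1 :=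
      Denumerable.encode_ofNat _
    refine ⟨⟨Denumerable.ofNat ℤ n.unpair.1, n.unpair.2, hpos.ne', ?_⟩, ?_⟩
    · rw [← Int.encode_succ_div_two, hz]
      exact hcop
    · rw [Rat.encode_eq_pair]
      dsimp only
      rw [hz, Nat.pair_unpair]

/-- The canonical enumeration of `ℚ` sends `q` to the number of codes below the standard code
of `q`. -/
theorem Rat.eqv_eq_length_filter (q : ℚ) :
    Denumerable.eqv ℚ q =
      ((List.range (Nat.pair (Encodable.encode q.num) q.den)).filter fun n =>
        decide (0 < n.unpair.2 ∧ ((n.unpair.1 + 1) / 2).gcd n.unpair.2 = 1)).length := by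
  have h : Denumerable.eqv ℚ q = (List.range (@Encodable.encode ℚ Rat.instEncodable q)).countP
    (fun n => @decide _ (@Encodable.decidableRangeEncode ℚ Rat.instEncodable n)) := rfl
  rw [h, Rat.encode_eq_pair, ← List.countP_eq_length_filter]
  refine List.countP_congr fun n _ => ?_
  simpa only [decide_eq_true_eq] using Rat.mem_range_encode_iff n

/-- Forming a quotient of natural numbers is primitive recursive, for the canonical enumeration
of `ℚ`. -/
theorem primrec₂_natCast_div : Primrec₂ fun a b : ℕ => (a : ℚ) / b := by
  have hpred : PrimrecPred fun n : ℕ =>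
      0 < n.unpair.2 ∧ ((n.unpair.1 + 1) / 2).gcd n.unpair.2 = 1 := by
    refine PrimrecPred.and ?_ ?_
    · exact Primrec.nat_lt.comp (Primrec.const 0) (Primrec.snd.comp Primrec.unpair)
    · exact Primrec.eq.comp (primrec₂_gcd.comp
        (Primrec.nat_div.comp (Primrec.succ.comp (Primrec.fst.comp Primrec.unpair))
          (Primrec.const 2)) (Primrec.snd.comp Primrec.unpair)) (Primrec.const 1)
  have hcode : Primrec₂ fun a b : ℕ =>
      ((List.range (Nat.pair (2 * (a / a.gcd b)) (b / a.gcd b))).filter fun n =>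
        decide (0 < n.unpair.2 ∧ ((n.unpair.1 + 1) / 2).gcd n.unpair.2 = 1)).length := by
    refine Primrec.list_length.comp ((Primrec.listFilter hpred).comp (Primrec.list_range.comp ?_))
    have hdiv {f : ℕ × ℕ → ℕ} (hf : Primrec f) : Primrec fun p => f p / p.1.gcd p.2 :=
      Primrec.nat_div.comp hf primrec₂_gcd
    exact Primrec₂.natPair.comp
      (Primrec.nat_mul.comp (Primrec.const 2) (hdiv Primrec.fst)) (hdiv Primrec.snd)
  refine Primrec.ite (c := fun p : ℕ × ℕ => p.2 = 0) (f := fun _ => (0 : ℚ))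
    (g := fun p => (Denumerable.eqv ℚ).symm (((List.range (Nat.pair (2 * (p.1 / p.1.gcd p.2))
      (p.2 / p.1.gcd p.2))).filter fun n : ℕ =>
        decide (0 < n.unpair.2 ∧ ((n.unpair.1 + 1) / 2).gcd n.unpair.2 = 1)).length))
    (Primrec.eq.comp Primrec.snd (Primrec.const 0)) (Primrec.const 0)
    ((Primrec.of_equiv_symm (e := Denumerable.eqv ℚ)).comp hcode) |>.of_eq fun p => ?_
  obtain ⟨a, b⟩ := p
  dsimp only
  split_ifs with hb
  · simp [hb]
  have hg : 0 < a.gcd b := Nat.gcd_pos_of_pos_right a (Nat.pos_of_ne_zero hb)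
  have hcop := Nat.coprime_div_gcd_div_gcd hg
  have hpos : 0 < b / a.gcd b := Nat.div_pos (Nat.gcd_le_right a (Nat.pos_of_ne_zero hb)) hg
  have hq : (a : ℚ) / b = (((a / a.gcd b : ℕ) : ℤ) : ℚ) / (((b / a.gcd b : ℕ) : ℤ) : ℚ) := by
    have hg' : ((a.gcd b : ℕ) : ℚ) ≠ 0 := by exact_mod_cast hg.ne'
    rw [Int.cast_natCast, Int.cast_natCast, Nat.cast_div (Nat.gcd_dvd_left a b) hg',
      Nat.cast_div (Nat.gcd_dvd_right a b) hg', div_div_div_cancel_right₀ hg']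
  rw [Equiv.symm_apply_eq, Rat.eqv_eq_length_filter]
  have hnum : ((a : ℚ) / b).num = ((a / a.gcd b : ℕ) : ℤ) := by
    rw [hq]
    exact Rat.num_div_eq_of_coprime (by exact_mod_cast hpos) hcop
  have hden : ((a : ℚ) / b).den = b / a.gcd b := by
    have := Rat.den_div_eq_of_coprime (a := ((a / a.gcd b : ℕ) : ℤ)) (b := ((b / a.gcd b : ℕ) : ℤ))
      (by exact_mod_cast hpos) hcop
    rw [hq]
    exact_mod_cast this
  rw [hnum, hden]
  rfl

/-- The capital of a gambler who always bets the fraction `δ` of the current capital on the next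
bit being `b`, after the bits `x`. -/
noncomputable def betCapital (b : Bool) (δ : ℝ) (x : List Bool) : ℝ :=
  (1 + δ) ^ x.count b * (1 - δ) ^ x.count (!b)

theorem isMartingale_betCapital (b : Bool) {δ : ℝ} (h0 : 0 ≤ δ) (h1 : δ ≤ 1) :
    IsMartingale (betCapital b δ) := by
  refine ⟨fun x => ?_, fun x => ?_⟩
  · have : 0 ≤ 1 - δ := sub_nonneg.2 h1
    unfold betCapital
    positivity
  · cases b <;> simp [betCapital, pow_succ] <;> ring

theorem computableFn_betCapital (b : Bool) {D : ℕ} (hD : 0 < D) :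
    ComputableFn (betCapital b (1 / D)) := by
  have hnum : Primrec fun x : List Bool => (D + 1) ^ x.count b * (D - 1) ^ x.count (!b) :=
    Primrec.nat_mul.comp
      (primrec₂_pow.comp (Primrec.const (D + 1)) (primrec_list_count b))
      (primrec₂_pow.comp (Primrec.const (D - 1)) (primrec_list_count !b))
  have hden : Primrec fun x : List Bool => D ^ (x.count b + x.count !b) :=
    primrec₂_pow.comp (Primrec.const D)
      (Primrec.nat_add.comp (primrec_list_count b) (primrec_list_count !b))
  refine ⟨fun x _ => (((D + 1) ^ x.count b * (D - 1) ^ x.count (!b) : ℕ) : ℚ) /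
    ((D ^ (x.count b + x.count !b) : ℕ) : ℚ),
    ((primrec₂_natCast_div.comp hnum hden).comp Primrec.fst).to_comp, fun x n => ?_⟩
  have hD' : (D : ℝ) ≠ 0 := by exact_mod_cast hD.ne'
  have heq : (((((D + 1) ^ x.count b * (D - 1) ^ x.count (!b) : ℕ) : ℚ) /
      ((D ^ (x.count b + x.count !b) : ℕ) : ℚ) : ℚ) : ℝ) = betCapital b (1 / D) x := by
    push_cast [Nat.cast_sub hD]
    have h1 : 1 + 1 / (D : ℝ) = (D + 1) / D := by field_simp
    have h2 : 1 - 1 / (D : ℝ) = (D - 1) / D := by field_simp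
    rw [betCapital, h1, h2, div_pow, div_pow, pow_add, div_mul_div_comm]
  rw [heq, sub_self, abs_zero]
  positivity

theorem prefixFn_succ (ω : ℕ → Bool) (n : ℕ) : prefixFn ω (n + 1) = prefixFn ω n ++ [ω n] := by
  simp only [prefixFn, List.ofFn_succ_last, Fin.val_castSucc, Fin.val_last]

theorem count_prefixFn (ω : ℕ → Bool) (b : Bool) (n : ℕ) :
    (prefixFn ω n).count b = ((Finset.range n).filter fun i => ω i = b).card := by
  induction n with
  | zero => simp [prefixFn]
  | succ n ih =>
    rw [prefixFn_succ, List.count_append, ih, Finset.range_add_one, Finset.filter_insert]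
    split_ifs with h <;> simp [h]

theorem count_add_count_not_prefixFn (ω : ℕ → Bool) (b : Bool) (n : ℕ) :
    (prefixFn ω n).count b + (prefixFn ω n).count (!b) = n := by
  rw [List.count_add_count_not]
  exact List.length_ofFn

/-- If some bit has frequency at least `1 / 2 + ε` infinitely often, betting a small fraction
`δ < 2 * ε` on it wins exponentially. -/
theorem exists_frequently_pow_le_betCapital {ω : ℕ → Bool} {b : Bool} {δ ε : ℝ}
    (h0 : 0 < δ) (h1 : δ < 1) (hδ : δ < 2 * ε)
    (h : ∃ᶠ n : ℕ in atTop, (1 / 2 + ε) * (n : ℝ) ≤ (prefixFn ω n).count b) :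
    ∃ c : ℝ, 1 < c ∧ ∃ᶠ n in atTop, c ^ n ≤ betCapital b δ (prefixFn ω n) := by
  have hp : 0 < 1 + δ := by linarith
  have hm : 0 < 1 - δ := by linarith
  have hlogp : δ / (1 + δ) ≤ Real.log (1 + δ) := by
    have := Real.one_sub_inv_le_log_of_pos hp
    convert this using 1
    field_simp
    ring
  have hlogm : -(δ / (1 - δ)) ≤ Real.log (1 - δ) := by
    have := Real.one_sub_inv_le_log_of_pos hm
    convert this using 1
    field_simp
    ring
  have hlogm' : Real.log (1 - δ) ≤ 0 := Real.log_nonpos hm.le (by linarith)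
  have hlogp' : 0 ≤ Real.log (1 + δ) := Real.log_nonneg (by linarith)
  have hrate : 0 < (1 / 2 + ε) * Real.log (1 + δ) + (1 / 2 - ε) * Real.log (1 - δ) := by
    rcases le_or_gt (1 / 2) ε with hε | hε
    · have : 0 < δ / (1 + δ) := by positivity
      nlinarith
    · have hpos : 0 < (1 / 2 + ε) * (δ / (1 + δ)) - (1 / 2 - ε) * (δ / (1 - δ)) := by
        have : (1 / 2 + ε) * (δ / (1 + δ)) - (1 / 2 - ε) * (δ / (1 - δ)) =
            δ * (2 * ε - δ) / ((1 + δ) * (1 - δ)) := by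
          field_simp
          ring
        rw [this]
        have : 0 < 2 * ε - δ := by linarith
        positivity
      have hε' : 0 < 1 / 2 + ε := by linarith
      nlinarith
  refine ⟨_, Real.one_lt_exp_iff.2 hrate, h.mono fun n hn => ?_⟩
  have hcount : ((prefixFn ω n).count b : ℝ) + (prefixFn ω n).count (!b) = n := by
    exact_mod_cast count_add_count_not_prefixFn ω b n
  have hexp : betCapital b δ (prefixFn ω n) = Real.exp ((prefixFn ω n).count b * Real.log (1 + δ) +
      (prefixFn ω n).count (!b) * Real.log (1 - δ)) := by
    rw [Real.exp_add, Real.exp_nat_mul, Real.exp_nat_mul, Real.exp_log hp, Real.exp_log hm,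
      betCapital]
  rw [hexp, ← Real.exp_nat_mul, Real.exp_le_exp]
  nlinarith

/-- A sequence without limit frequency `1 / 2` has infinitely often too many occurrences of
one of the two bits. -/
theorem exists_frequently_le_count_of_not_limitFreq {ω : ℕ → Bool} (hω : ¬ LimitFreq ω (1 / 2)) :
    ∃ b : Bool, ∃ ε : ℝ, 0 < ε ∧
      ∃ᶠ n : ℕ in atTop, (1 / 2 + ε) * (n : ℝ) ≤ (prefixFn ω n).count b := by
  unfold LimitFreq at hω
  rw [Metric.tendsto_nhds] at hω
  push Not at hω
  obtain ⟨ε, hε, hfreq⟩ := hω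
  have hor : ∃ᶠ n : ℕ in atTop, ((1 / 2 + ε) * (n : ℝ) ≤ (prefixFn ω n).count true) ∨
      ((1 / 2 + ε) * (n : ℝ) ≤ (prefixFn ω n).count false) := by
    refine (hfreq.and_eventually (eventually_gt_atTop 0)).mono ?_
    rintro n ⟨hn, hpos⟩
    have hpos' : (0 : ℝ) < n := by exact_mod_cast hpos
    have hcount : ((prefixFn ω n).count true : ℝ) + (prefixFn ω n).count false = n := by
      exact_mod_cast count_add_count_not_prefixFn ω true n
    rw [← count_prefixFn, Real.dist_eq, le_abs] at hn
    rcases hn with hn | hn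
    · left
      rw [← le_div_iff₀ hpos']
      linarith
    · right
      have : ((prefixFn ω n).count true : ℝ) / n ≤ 1 / 2 - ε := by linarith
      rw [div_le_iff₀ hpos'] at this
      linarith
  rcases frequently_or_distrib.1 hor with h | h
  · exact ⟨true, ε, hε, h⟩
  · exact ⟨false, ε, hε, h⟩

/-- **Schnorr's exponential-winning theorem.** If `ω` does not satisfy the strong law of
large numbers (does not have limit frequency `1/2`), then some computable martingale
wins exponentially fast against it. -/
theorem exp_win_of_not_slln (ω : ℕ → Bool) (hω : ¬ LimitFreq ω (1 / 2)) :
    ∃ m : List Bool → ℝ, IsMartingale m ∧ ComputableFn m ∧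
      ∃ c : ℝ, 1 < c ∧ ∃ᶠ n in atTop, c ^ n ≤ m (prefixFn ω n) := by
  obtain ⟨b, ε, hε, hfreq⟩ := exists_frequently_le_count_of_not_limitFreq hω
  obtain ⟨k, hk⟩ := exists_nat_one_div_lt (lt_min (mul_pos two_pos hε) one_pos)
  have hk' : 1 / ((k + 1 : ℕ) : ℝ) < min (2 * ε) 1 := by exact_mod_cast hk
  have hpos : 0 < 1 / ((k + 1 : ℕ) : ℝ) := by positivity
  obtain ⟨h2, h1⟩ := lt_min_iff.1 hk'
  exact ⟨betCapital b (1 / (k + 1 : ℕ)), isMartingale_betCapital b hpos.le h1.le,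
    computableFn_betCapital b k.succ_pos, exists_frequently_pow_le_betCapital hpos h1 h2 hfreq⟩
end

section
/- Existence of an explicitly definable random sequence (Martin-Löf): there exists a computable predicate R : ℕ → ℕ → ℕ → Bool such that the sequence ω : ℕ → Bool defined by (ω n = true ↔ ∃ p, ∀ q, R n p q = true) is Martin-Löf random; that is, some Σ⁰₂ sequence is Martin-Löf random. -/
open Filter MeasureTheory Set
open scoped ENNReal

namespace MartinLof

open Nat.Partrec (Code)

section Primrec

variable {α : Type*} [Primcodable α]

theorem primrec_two_pow : Primrec fun n : ℕ => 2 ^ n :=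
  (Primrec.nat_rec₁ (f := fun _ m => m * 2) 1
    (Primrec.nat_mul.comp Primrec.snd (Primrec.const 2))).of_eq fun n => by
      induction n with
      | zero => rfl
      | succ n ih => rw [pow_succ, ← ih]

theorem primrec_sum_range {f : α → ℕ → ℕ} {n : α → ℕ} (hf : Primrec₂ f) (hn : Primrec n) :
    Primrec fun a => ∑ i ∈ Finset.range (n a), f a i := by
  refine (Primrec.nat_rec' (g := fun _ => 0) (h := fun a p => p.2 + f a p.1) hn
    (Primrec.const 0) ?_).of_eq fun a => ?_
  · exact Primrec.nat_add.comp (Primrec.snd.comp Primrec.snd)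
      (hf.comp Primrec.fst (Primrec.fst.comp Primrec.snd))
  · induction n a with
    | zero => rfl
    | succ k ih => rw [Finset.sum_range_succ, ← ih]

theorem primrec_option_elim {β σ : Type*} [Primcodable β] [Primcodable σ] {o : α → Option β}
    {d : α → σ} {f : α → β → σ} (ho : Primrec o) (hd : Primrec d) (hf : Primrec₂ f) :
    Primrec fun a => (o a).elim (d a) (f a) :=
  (Primrec.option_casesOn ho hd hf).of_eq fun a => by cases o a <;> rfl

end Primrec

/-! ### Leftmost paths avoiding a semidecidable set of strings -/

/-- The path that takes the left turn unless this leads into `D`. -/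
noncomputable def path (D : List Bool → Prop) : ℕ → List Bool
  | 0 => []
  | n + 1 => open Classical in path D n ++ [decide (D (path D n ++ [false]))]

/-- The infinite sequence traced by `path D`. -/
noncomputable def pathSeq (D : List Bool → Prop) (n : ℕ) : Bool :=
  open Classical in decide (D (path D n ++ [false]))

theorem prefixFn_succ (ω : ℕ → Bool) (n : ℕ) : prefixFn ω (n + 1) = prefixFn ω n ++ [ω n] := by
  rw [prefixFn, List.ofFn_succ_last]
  rfl

theorem prefixFn_pathSeq (D : List Bool → Prop) (n : ℕ) : prefixFn (pathSeq D) n = path D n := by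
  induction n with
  | zero => simp [prefixFn, path]
  | succ n ih => rw [prefixFn_succ, ih]; rfl

/-- One step in the verification of an annotated string: the annotation `0` stands for the bit
`false` and is refuted at stage `q`, the annotation `s + 1` stands for the bit `true` and is
confirmed at stage `s`. -/
def verifyStep (D : List Bool → ℕ → Bool) (q : ℕ) (x : List Bool) (c : ℕ) : Option (List Bool) :=
  bif c == 0 then bif D (x ++ [false]) q then none else some (x ++ [false])
  else bif D (x ++ [false]) (c - 1) then some (x ++ [true]) else none

/-- Verification of an annotated string up to stage `q`. -/
def verify (D : List Bool → ℕ → Bool) (q : ℕ) (l : List ℕ) : Option (List Bool) :=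
  l.foldl (fun o c => o.bind fun x => verifyStep D q x c) (some [])

theorem verify_concat (D : List Bool → ℕ → Bool) (q : ℕ) (l : List ℕ) (c : ℕ) :
    verify D q (l ++ [c]) = (verify D q l).bind fun x => verifyStep D q x c := by
  simp [verify]

theorem verify_eq_path {D : List Bool → ℕ → Bool} {l : List ℕ}
    (h : ∀ q, verify D q l ≠ none) (q : ℕ) :
    verify D q l = some (path (fun x => ∃ s, D x s = true) l.length) := by
  induction l using List.reverseRecOn generalizing q with
  | nil => rfl
  | append_singleton l c ih =>
    have ih := ih fun q hq => h q (by rw [verify_concat, hq]; rfl)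
    simp only [verify_concat, ih, Option.bind_some, verifyStep] at h ⊢
    rw [List.length_append, List.length_singleton, path]
    rcases c with _ | c
    · have h' : ∀ s, D (path (fun x => ∃ s, D x s = true) l.length ++ [false]) s = false := by
        intro s
        by_contra hs
        exact h s (by simp [hs])
      simp [h']
    · have h' : D (path (fun x => ∃ s, D x s = true) l.length ++ [false]) c = true := by
        by_contra hs
        exact h 0 (by simp [hs])
      have h'' : ∃ s, D (path (fun x => ∃ s, D x s = true) l.length ++ [false]) s = true := ⟨c, h'⟩
      simp [h', h'']

theorem exists_verify (D : List Bool → ℕ → Bool) (n : ℕ) :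
    ∃ l : List ℕ, l.length = n ∧
      ∀ q, verify D q l = some (path (fun x => ∃ s, D x s = true) n) := by
  induction n with
  | zero => exact ⟨[], rfl, fun q => rfl⟩
  | succ n ih =>
    obtain ⟨l, hl, hv⟩ := ih
    by_cases h : ∃ s, D (path (fun x => ∃ s, D x s = true) n ++ [false]) s = true
    · obtain ⟨s, hs⟩ := h
      refine ⟨l ++ [s + 1], by simp [hl], fun q => ?_⟩
      have h' : ∃ s, D (path (fun x => ∃ s, D x s = true) n ++ [false]) s = true := ⟨s, hs⟩
      simp [verify_concat, hv, verifyStep, hs, path, h']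
    · refine ⟨l ++ [0], by simp [hl], fun q => ?_⟩
      have h' : ∀ s, D (path (fun x => ∃ s, D x s = true) n ++ [false]) s = false := by
        simpa using h
      simp [verify_concat, hv, verifyStep, path, h']

/-- The matrix of a `Σ⁰₂` definition of the sequence `pathSeq`. -/
def pathMatrix (D : List Bool → ℕ → Bool) (n p q : ℕ) : Bool :=
  decide ((Denumerable.ofNat (List ℕ × ℕ) p).1.length = n) &&
    (verify D q (Denumerable.ofNat (List ℕ × ℕ) p).1).elim false
      fun x => D (x ++ [false]) (Denumerable.ofNat (List ℕ × ℕ) p).2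

theorem pathSeq_eq_true_iff (D : List Bool → ℕ → Bool) (n : ℕ) :
    pathSeq (fun x => ∃ s, D x s = true) n = true ↔ ∃ p, ∀ q, pathMatrix D n p q = true := by
  unfold pathSeq
  simp only [decide_eq_true_eq]
  constructor
  · rintro ⟨s, hs⟩
    obtain ⟨l, hl, hv⟩ := exists_verify D n
    exact ⟨Encodable.encode (l, s), fun q => by simp [pathMatrix, hl, hv, hs]⟩
  · rintro ⟨p, hp⟩
    simp only [pathMatrix, Bool.and_eq_true, decide_eq_true_iff] at hp
    obtain ⟨rfl, -⟩ := hp 0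
    have hv := verify_eq_path (D := D) (l := (Denumerable.ofNat (List ℕ × ℕ) p).1) fun q hq => by
      have := (hp q).2
      rw [hq] at this
      cases this
    have := (hp 0).2
    rw [hv 0] at this
    exact ⟨_, this⟩

theorem primrec_verify {D : List Bool → ℕ → Bool} (hD : Primrec₂ D) :
    Primrec₂ fun (q : ℕ) (l : List ℕ) => verify D q l := by
  refine Primrec.list_foldl (f := fun p : ℕ × List ℕ => p.2) (g := fun _ => some [])
    (h := fun p t => t.1.bind fun x => verifyStep D p.1 x t.2) Primrec.snd (Primrec.const _) ?_
  refine Primrec.option_bind (Primrec.fst.comp Primrec.snd) ?_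
  have hx : Primrec fun t : ((ℕ × List ℕ) × Option (List Bool) × ℕ) × List Bool => t.2 :=
    Primrec.snd
  have hc : Primrec fun t : ((ℕ × List ℕ) × Option (List Bool) × ℕ) × List Bool => t.1.2.2 :=
    Primrec.snd.comp (Primrec.snd.comp Primrec.fst)
  have hq : Primrec fun t : ((ℕ × List ℕ) × Option (List Bool) × ℕ) × List Bool => t.1.1.1 :=
    Primrec.fst.comp (Primrec.fst.comp Primrec.fst)
  have hb (b : Bool) : Primrec fun t : ((ℕ × List ℕ) × Option (List Bool) × ℕ) × List Bool =>
    t.2 ++ [b] := Primrec.list_concat.comp hx (Primrec.const b)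
  exact Primrec.cond (Primrec.beq.comp hc (Primrec.const 0))
    (Primrec.cond (hD.comp (hb false) hq) (Primrec.const none) (Primrec.option_some.comp (hb false)))
    (Primrec.cond (hD.comp (hb false) (Primrec.nat_sub.comp hc (Primrec.const 1)))
      (Primrec.option_some.comp (hb true)) (Primrec.const none))

theorem primrec_pathMatrix {D : List Bool → ℕ → Bool} (hD : Primrec₂ D) :
    Primrec fun t : ℕ × ℕ × ℕ => pathMatrix D t.1 t.2.1 t.2.2 := by
  have hp : Primrec fun t : ℕ × ℕ × ℕ => Denumerable.ofNat (List ℕ × ℕ) t.2.1 :=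
    (Primrec.ofNat _).comp (Primrec.fst.comp Primrec.snd)
  refine Primrec.and.comp
    (Primrec.eq.decide.comp (Primrec.list_length.comp (Primrec.fst.comp hp)) Primrec.fst) ?_
  refine primrec_option_elim
    ((primrec_verify hD).comp (Primrec.snd.comp Primrec.snd) (Primrec.fst.comp hp))
    (Primrec.const false) ?_
  exact hD.comp (Primrec.list_concat.comp Primrec.snd (Primrec.const false))
    (Primrec.snd.comp (hp.comp Primrec.fst))

/-! ### The weight of a string relative to another one -/

/-- The measure of the cylinder of `w`, if there is one. -/
noncomputable def weight (o : Option (List Bool)) : ℝ≥0∞ :=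
  o.elim 0 fun w => ((2 : ℝ≥0∞) ^ w.length)⁻¹

/-- The relative measure of the cylinder of `w`, if there is one, in the cylinder of `x`. -/
noncomputable def relWeight (o : Option (List Bool)) (x : List Bool) : ℝ≥0∞ :=
  o.elim 0 fun w =>
    if w.take x.length = x.take w.length then ((2 : ℝ≥0∞) ^ (w.length - x.length))⁻¹ else 0

theorem relWeight_nil (o : Option (List Bool)) : relWeight o [] = weight o := by
  cases o <;> simp [relWeight, weight]

theorem relWeight_self (w : List Bool) : relWeight (some w) w = 1 := by
  simp [relWeight]

theorem relWeight_children_le (o : Option (List Bool)) (x : List Bool) :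
    relWeight o (x ++ [false]) + relWeight o (x ++ [true]) ≤ 2 * relWeight o x := by
  rcases o with _ | w
  · simp [relWeight]
  simp only [relWeight, Option.elim_some, List.length_append, List.length_singleton]
  rcases le_or_gt w.length x.length with h | h
  · have h1 : w.length - (x.length + 1) = 0 := by omega
    have h2 : w.length - x.length = 0 := by omega
    simp [h1, h2, List.take_append_of_le_length h, List.take_of_length_le h,
      List.take_of_length_le (h.trans (Nat.le_succ _))]
    split_ifs <;> norm_num
  · obtain ⟨d, hd⟩ := Nat.exists_eq_add_of_lt h
    have hw : w.take (x.length + 1) = w.take x.length ++ [w[x.length]] := by simp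
    have hx (b : Bool) : (x ++ [b]).take w.length = x ++ [b] :=
      List.take_of_length_le (by simpa using h)
    have hinv : ((2 : ℝ≥0∞) ^ d)⁻¹ = 2 * ((2 : ℝ≥0∞) ^ (d + 1))⁻¹ := by
      rw [pow_succ', ENNReal.mul_inv (by simp) (by simp), ← mul_assoc,
        ENNReal.mul_inv_cancel (by simp) (by simp), one_mul]
    have e1 : w.length - (x.length + 1) = d := by omega
    have e2 : w.length - x.length = d + 1 := by omega
    rw [hw, hx, hx, List.take_of_length_le h.le, e1, e2, hinv]
    simp only [← List.concat_eq_append, List.concat_inj]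
    by_cases hwx : w.take x.length = x <;> cases w[x.length] <;> simp [hwx]

/-! ### A universal test -/

/-- The `i`-th output at stage `s` of the test with index `e`, at level `e + 2`. -/
def evalStage (e i s : ℕ) : Option (Option (List Bool)) :=
  (Code.evaln s (Denumerable.ofNat Code e) (Nat.pair (e + 2) i)).bind Encodable.decode

theorem evalStage_mono {e i s t : ℕ} (hst : s ≤ t) {o : Option (List Bool)}
    (h : evalStage e i s = some o) : evalStage e i t = some o := by
  obtain ⟨n, hn, hd⟩ := Option.bind_eq_some_iff.1 h
  exact Option.bind_eq_some_iff.2 ⟨n, Code.evaln_mono hst hn, hd⟩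

theorem evalStage_unique {e i s t : ℕ} {o o' : Option (List Bool)}
    (h : evalStage e i s = some o) (h' : evalStage e i t = some o') : o = o' := by
  have h1 := evalStage_mono (le_max_left s t) h
  rw [evalStage_mono (le_max_right s t) h'] at h1
  exact (Option.some.inj h1).symm

/-- `2 ^ s` times the weight of the `i`-th output at stage `s`, or `2 ^ s + 1` if this output is
not yet available or too long. -/
def stageWeight (e i s : ℕ) : ℕ :=
  (evalStage e i s).elim (2 ^ s + 1) fun o => o.elim 0 fun w =>
    if w.length ≤ s then 2 ^ (s - w.length) else 2 ^ s + 1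

theorem two_pow_sub {s k : ℕ} (h : k ≤ s) : (2 : ℝ≥0∞) ^ (s - k) = 2 ^ s * (2 ^ k)⁻¹ := by
  obtain ⟨d, rfl⟩ := Nat.exists_eq_add_of_le h
  rw [Nat.add_sub_cancel_left, pow_add, mul_comm, ← mul_assoc,
    ENNReal.inv_mul_cancel (by simp) (by simp), one_mul]

theorem stageWeight_eq {e i s : ℕ} {o : Option (List Bool)} (h : evalStage e i s = some o)
    (ho : ∀ w ∈ o, w.length ≤ s) : (stageWeight e i s : ℝ≥0∞) = 2 ^ s * weight o := by
  rcases o with _ | w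
  · simp [stageWeight, h, weight]
  · have hw := ho w rfl
    simp [stageWeight, h, weight, hw, two_pow_sub hw]

theorem exists_of_stageWeight_le {e i s : ℕ} (h : stageWeight e i s ≤ 2 ^ s) :
    ∃ o, evalStage e i s = some o ∧ ∀ w ∈ o, w.length ≤ s := by
  unfold stageWeight at h
  rcases hv : evalStage e i s with _ | o
  · simp [hv] at h
  · refine ⟨o, rfl, ?_⟩
    rintro w rfl
    by_contra hw
    simp [hv, hw] at h

/-- The first `i + 1` outputs are available at stage `s`, with total weight at most
`2 ^ (-(e + 2))`. -/
def Accepted (e i s : ℕ) : Prop :=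
  (∑ j ∈ Finset.range (i + 1), stageWeight e j s) * 2 ^ (e + 2) ≤ 2 ^ s

instance (e i s : ℕ) : Decidable (Accepted e i s) := by unfold Accepted; infer_instance

theorem accepted_iff_of_forall {e i s : ℕ} {o : ℕ → Option (List Bool)}
    (h : ∀ j ≤ i, evalStage e j s = some (o j)) (ho : ∀ j ≤ i, ∀ w ∈ o j, w.length ≤ s) :
    Accepted e i s ↔ ∑ j ∈ Finset.range (i + 1), weight (o j) ≤ ((2 : ℝ≥0∞) ^ (e + 2))⁻¹ := by
  have hsum : ((∑ j ∈ Finset.range (i + 1), stageWeight e j s : ℕ) : ℝ≥0∞) =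
      2 ^ s * ∑ j ∈ Finset.range (i + 1), weight (o j) := by
    rw [Nat.cast_sum, Finset.mul_sum]
    refine Finset.sum_congr rfl fun j hj => ?_
    have hj := Nat.lt_succ_iff.1 (Finset.mem_range.1 hj)
    exact stageWeight_eq (h j hj) (ho j hj)
  rw [Accepted, ← Nat.cast_le (α := ℝ≥0∞), Nat.cast_mul, hsum, mul_assoc]
  push_cast
  conv_lhs => rhs; rw [← mul_one ((2 : ℝ≥0∞) ^ s)]
  rw [ENNReal.mul_le_mul_iff_right (by simp) (by simp), ENNReal.le_inv_iff_mul_le]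

theorem Accepted.exists_output {e i s j : ℕ} (h : Accepted e i s) (hj : j ≤ i) :
    ∃ o, evalStage e j s = some o ∧ ∀ w ∈ o, w.length ≤ s := by
  refine exists_of_stageWeight_le ?_
  calc stageWeight e j s
      ≤ ∑ j ∈ Finset.range (i + 1), stageWeight e j s :=
        Finset.single_le_sum (f := fun j => stageWeight e j s) (fun _ _ => Nat.zero_le _)
          (Finset.mem_range.2 (Nat.lt_succ_iff.2 hj))
    _ ≤ _ := Nat.le_mul_of_pos_right _ (by positivity)
    _ ≤ 2 ^ s := h

theorem Accepted.exists_outputs {e i s : ℕ} (h : Accepted e i s) :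
    ∃ o : ℕ → Option (List Bool), (∀ j ≤ i, evalStage e j s = some (o j)) ∧
      (∀ j ≤ i, ∀ w ∈ o j, w.length ≤ s) ∧
      ∑ j ∈ Finset.range (i + 1), weight (o j) ≤ ((2 : ℝ≥0∞) ^ (e + 2))⁻¹ := by
  choose! o ho using fun j (hj : j ≤ i) => h.exists_output hj
  have h1 := fun j hj => (ho j hj).1
  have h2 := fun j hj => (ho j hj).2
  exact ⟨o, h1, h2, (accepted_iff_of_forall h1 h2).1 h⟩

theorem Accepted.mono {e i s t : ℕ} (h : Accepted e i s) (hst : s ≤ t) : Accepted e i t := by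
  obtain ⟨o, h1, h2, h3⟩ := h.exists_outputs
  exact (accepted_iff_of_forall (fun j hj => evalStage_mono hst (h1 j hj))
    fun j hj w hw => (h2 j hj w hw).trans hst).2 h3

/-- The string contributed by `m = Nat.pair e i` to the universal test at stage `s`. -/
def stageString (m s : ℕ) : Option (List Bool) :=
  if Accepted m.unpair.1 m.unpair.2 s then (evalStage m.unpair.1 m.unpair.2 s).bind id else none

theorem stageString_eq_some_iff {m s : ℕ} {w : List Bool} : stageString m s = some w ↔
    Accepted m.unpair.1 m.unpair.2 s ∧ evalStage m.unpair.1 m.unpair.2 s = some (some w) := by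
  by_cases h : Accepted m.unpair.1 m.unpair.2 s <;>
    simp [stageString, h, Option.bind_eq_some_iff]

theorem stageString_mono {m s t : ℕ} (hst : s ≤ t) {w : List Bool}
    (h : stageString m s = some w) : stageString m t = some w := by
  rw [stageString_eq_some_iff] at h ⊢
  exact ⟨h.1.mono hst, evalStage_mono hst h.2⟩

theorem length_le_of_stageString {m s : ℕ} {w : List Bool} (h : stageString m s = some w) :
    w.length ≤ s := by
  rw [stageString_eq_some_iff] at h
  obtain ⟨o, ho, hl⟩ := h.1.exists_output le_rfl
  exact hl w (evalStage_unique ho h.2)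

open Classical in
/-- The string eventually contributed by `m` to the universal test. -/
noncomputable def limitString (m : ℕ) : Option (List Bool) :=
  if h : ∃ s w, stageString m s = some w then some h.choose_spec.choose else none

theorem limitString_eq_some_iff {m : ℕ} {w : List Bool} :
    limitString m = some w ↔ ∃ s, stageString m s = some w := by
  unfold limitString
  constructor
  · intro h
    split_ifs at h with hs
    obtain rfl := Option.some.inj h
    exact ⟨_, hs.choose_spec.choose_spec⟩
  · rintro ⟨s, hw⟩
    have hs : ∃ s w, stageString m s = some w := ⟨s, w, hw⟩
    rw [dif_pos hs]
    have h1 := hs.choose_spec.choose_spec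
    rw [stageString_eq_some_iff] at h1 hw
    exact evalStage_unique h1.2 hw.2

theorem sum_weight_limitString_le (e n : ℕ) :
    ∑ i ∈ Finset.range n, weight (limitString (Nat.pair e i)) ≤ ((2 : ℝ≥0∞) ^ (e + 2))⁻¹ := by
  induction n with
  | zero => simp
  | succ n ih =>
    rcases hn : limitString (Nat.pair e n) with _ | w
    · rw [Finset.sum_range_succ, hn]
      simpa [weight] using ih
    · obtain ⟨s, hs⟩ := limitString_eq_some_iff.1 hn
      rw [stageString_eq_some_iff, Nat.unpair_pair] at hs
      obtain ⟨o, ho, -, hle⟩ := hs.1.exists_outputs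
      refine (Finset.sum_le_sum fun j hj => ?_).trans hle
      rcases hj' : limitString (Nat.pair e j) with _ | w'
      · simp [weight]
      · obtain ⟨t, ht⟩ := limitString_eq_some_iff.1 hj'
        rw [stageString_eq_some_iff, Nat.unpair_pair] at ht
        rw [evalStage_unique (ho j (Nat.lt_succ_iff.1 (Finset.mem_range.1 hj))) ht.2]

theorem tsum_weight_limitString_le : 2 * ∑' m, weight (limitString m) ≤ 1 := by
  rw [← Nat.pairEquiv.tsum_eq, ENNReal.tsum_prod']
  have h1 : ∀ e : ℕ, ∑' i, weight (limitString (Nat.pairEquiv (e, i))) ≤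
      2⁻¹ * 2⁻¹ ^ (e + 1) := fun e =>
    (ENNReal.tsum_le_of_sum_range_le (sum_weight_limitString_le e)).trans_eq (by
      rw [← pow_succ', ENNReal.inv_pow])
  calc 2 * ∑' e, ∑' i, weight (limitString (Nat.pairEquiv (e, i)))
      ≤ 2 * ∑' e : ℕ, 2⁻¹ * 2⁻¹ ^ (e + 1) := by gcongr; exact h1 _
    _ = 1 := by
      rw [ENNReal.tsum_mul_left, ENNReal.tsum_geometric_add_one, ENNReal.one_sub_inv_two, inv_inv,
        ENNReal.inv_mul_cancel (by simp) (by simp), mul_one,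
        ENNReal.mul_inv_cancel (by simp) (by simp)]

/-- The relative weight of the universal test in the cylinder of `x`. -/
noncomputable def density (x : List Bool) : ℝ≥0∞ := ∑' m, relWeight (limitString m) x

theorem density_children_le (x : List Bool) :
    density (x ++ [false]) + density (x ++ [true]) ≤ 2 * density x := by
  rw [density, density, density, ← ENNReal.tsum_add, ← ENNReal.tsum_mul_left]
  exact ENNReal.tsum_le_tsum fun m => relWeight_children_le _ _

/-- `2 ^ s` times the relative weight of the stage `s` approximation to the universal test. -/
def stageDensity (s : ℕ) (x : List Bool) : ℕ :=
  ∑ m ∈ Finset.range s, (stageString m s).elim 0 fun w =>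
    if w.take x.length = x.take w.length then 2 ^ (s - (w.length - x.length)) else 0

theorem stageDensity_eq (s : ℕ) (x : List Bool) : (stageDensity s x : ℝ≥0∞) =
    2 ^ s * ∑ m ∈ Finset.range s, relWeight (stageString m s) x := by
  rw [stageDensity, Nat.cast_sum, Finset.mul_sum]
  refine Finset.sum_congr rfl fun m _ => ?_
  rcases h : stageString m s with _ | w
  · simp [relWeight]
  · have hw := length_le_of_stageString h
    simp only [relWeight, Option.elim_some]
    split_ifs
    · rw [← two_pow_sub (by omega)]; norm_cast
    · simp

/-- At stage `s` the relative weight of `x` is seen to exceed `1 / 2`. -/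
def heavy (x : List Bool) (s : ℕ) : Bool := decide (2 ^ s < 2 * stageDensity s x)

theorem heavy_iff (x : List Bool) (s : ℕ) : heavy x s = true ↔
    1 < 2 * ∑ m ∈ Finset.range s, relWeight (stageString m s) x := by
  rw [heavy, decide_eq_true_iff, ← Nat.cast_lt (α := ℝ≥0∞)]
  push_cast
  rw [stageDensity_eq, mul_left_comm]
  conv_lhs => lhs; rw [← mul_one ((2 : ℝ≥0∞) ^ s)]
  exact ENNReal.mul_lt_mul_iff_right (by simp) (by simp)

theorem relWeight_stageString_le (m s : ℕ) (x : List Bool) :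
    relWeight (stageString m s) x ≤ relWeight (limitString m) x := by
  rcases h : stageString m s with _ | w
  · simp [relWeight]
  · rw [limitString_eq_some_iff.2 ⟨s, h⟩]

theorem exists_stageString_eq (m : ℕ) : ∃ s, ∀ t ≥ s, stageString m t = limitString m := by
  rcases h : limitString m with _ | w
  · refine ⟨0, fun t _ => ?_⟩
    by_contra ht
    obtain ⟨w, hw⟩ := Option.ne_none_iff_exists'.1 ht
    rw [limitString_eq_some_iff.2 ⟨t, hw⟩] at h
    cases h
  · obtain ⟨s, hs⟩ := limitString_eq_some_iff.1 h
    exact ⟨s, fun t ht => stageString_mono ht hs⟩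

theorem exists_heavy_iff (x : List Bool) : (∃ s, heavy x s = true) ↔ 1 < 2 * density x := by
  simp only [heavy_iff]
  constructor
  · rintro ⟨s, hs⟩
    refine hs.trans_le ?_
    gcongr
    exact (Finset.sum_le_sum fun m _ => relWeight_stageString_le m s x).trans
      (ENNReal.sum_le_tsum _)
  · intro h
    rw [density, ← ENNReal.tsum_mul_left, ENNReal.tsum_eq_iSup_nat, lt_iSup_iff] at h
    obtain ⟨n, hn⟩ := h
    choose t ht using exists_stageString_eq
    refine ⟨max n ((Finset.range n).sup t), hn.trans_le ?_⟩
    rw [← Finset.mul_sum]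
    gcongr
    refine le_trans (Finset.sum_le_sum fun m hm => ?_)
      (Finset.sum_le_sum_of_subset (Finset.range_subset_range.2 (le_max_left _ _)))
    rw [ht m _ ((Finset.le_sup hm).trans (le_max_right _ _))]

theorem density_path_le (n : ℕ) : 2 * density (path (fun x => ∃ s, heavy x s = true) n) ≤ 1 := by
  induction n with
  | zero =>
    rw [path, density]
    simpa only [relWeight_nil] using tsum_weight_limitString_le
  | succ n ih =>
    rw [path]
    set x := path (fun x => ∃ s, heavy x s = true) n
    by_cases h : ∃ s, heavy (x ++ [false]) s = true
    · simp only [h, decide_true]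
      rw [exists_heavy_iff] at h
      by_contra! h'
      have h2 : 2 * (density (x ++ [false]) + density (x ++ [true])) ≤ 2 * 1 :=
        mul_le_mul_right ((density_children_le x).trans ih) 2
      rw [mul_add, two_mul 1] at h2
      exact absurd (ENNReal.add_lt_add h h') h2.not_gt
    · simp only [h, decide_false]
      rwa [exists_heavy_iff, not_lt] at h

/-- A test is eventually accepted by the universal test in its entirety. -/
theorem exists_limitString_eq {g : ℕ → ℕ → Option (List Bool)} (hg : Computable₂ g)
    (hw : ∀ k, ∑' n, weight (g k n) ≤ ((2 : ℝ≥0∞) ^ k)⁻¹) :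
    ∃ k e, ∀ i, limitString (Nat.pair e i) = g k i := by
  have hg' : Nat.Partrec fun n => Part.some (Encodable.encode (g n.unpair.1 n.unpair.2)) := by
    have : Computable fun n : ℕ => Encodable.encode (g n.unpair.1 n.unpair.2) :=
      Computable.encode.comp (hg.comp (Computable.fst.comp Computable.unpair)
        (Computable.snd.comp Computable.unpair))
    exact Partrec.nat_iff.1 this
  obtain ⟨c, hc⟩ := Code.exists_code.1 hg'
  obtain ⟨e, rfl⟩ : ∃ e, Denumerable.ofNat Code e = c := ⟨Encodable.encode c, by simp⟩
  refine ⟨e + 2, e, fun i => ?_⟩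
  have hs : ∀ j, ∃ s, evalStage e j s = some (g (e + 2) j) := fun j => by
    have : Encodable.encode (g (e + 2) j) ∈
        (Denumerable.ofNat Code e).eval (Nat.pair (e + 2) j) := by simp [hc]
    obtain ⟨s, hs⟩ := Code.evaln_complete.1 this
    exact ⟨s, Option.bind_eq_some_iff.2 ⟨_, hs, Encodable.encodek _⟩⟩
  choose s hs using hs
  set t := (Finset.range (i + 1)).sup fun j => max (s j) ((g (e + 2) j).elim 0 List.length)
  have ht : ∀ j ≤ i, max (s j) ((g (e + 2) j).elim 0 List.length) ≤ t := fun j hj =>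
    Finset.le_sup (f := fun j => max (s j) ((g (e + 2) j).elim 0 List.length))
      (Finset.mem_range.2 (Nat.lt_succ_iff.2 hj))
  have hev : ∀ j ≤ i, evalStage e j t = some (g (e + 2) j) := fun j hj =>
    evalStage_mono ((le_max_left _ _).trans (ht j hj)) (hs j)
  have hacc : Accepted e i t := by
    refine (accepted_iff_of_forall hev fun j hj w hw => ?_).2
      ((ENNReal.sum_le_tsum _).trans (hw (e + 2)))
    have := (le_max_right _ _).trans (ht j hj)
    rwa [Option.mem_def.1 hw] at this
  rcases hgi : g (e + 2) i with _ | w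
  · by_contra hne
    obtain ⟨w, hw⟩ := Option.ne_none_iff_exists'.1 hne
    obtain ⟨s', hs'⟩ := limitString_eq_some_iff.1 hw
    rw [stageString_eq_some_iff, Nat.unpair_pair] at hs'
    have := evalStage_unique hs'.2 (hs i)
    rw [hgi] at this
    cases this
  · refine limitString_eq_some_iff.2 ⟨t, stageString_eq_some_iff.2 ?_⟩
    rw [Nat.unpair_pair]
    exact ⟨hacc, hgi ▸ hev i le_rfl⟩

theorem mlRandom_pathSeq_heavy : MLRandom (pathSeq fun x => ∃ s, heavy x s = true) := by
  rintro X ⟨g, hg, hX⟩ hω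
  obtain ⟨k, e, he⟩ := exists_limitString_eq hg fun k => (hX k).2
  obtain ⟨i, w, hw, hcyl⟩ : ∃ i w, g k i = some w ∧
      (pathSeq fun x => ∃ s, heavy x s = true) ∈ cyl w := by
    simpa using (hX k).1 hω
  have h := density_path_le w.length
  rw [← prefixFn_pathSeq, show prefixFn _ w.length = w from hcyl] at h
  have h1 : 1 ≤ density w := by
    rw [← relWeight_self w, ← hw, ← he i]
    exact ENNReal.le_tsum (f := fun m => relWeight (limitString m) w) _
  have h2 : (2 : ℝ≥0∞) * 1 ≤ 1 := (mul_le_mul_right h1 2).trans h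
  norm_num at h2

/-! ### Primitive recursiveness of the approximations -/

theorem primrec_evalStage : Primrec fun t : ℕ × ℕ × ℕ => evalStage t.1 t.2.1 t.2.2 :=
  Primrec.option_bind
    (Code.primrec_evaln.comp
      (((Primrec.snd.comp Primrec.snd).pair ((Primrec.ofNat Code).comp Primrec.fst)).pair
        (Primrec₂.natPair.comp (Primrec.nat_add.comp Primrec.fst (Primrec.const 2))
          (Primrec.fst.comp Primrec.snd))))
    (Primrec.decode.comp Primrec.snd)

theorem primrec_stageWeight : Primrec fun t : ℕ × ℕ × ℕ => stageWeight t.1 t.2.1 t.2.2 := by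
  have hs : Primrec fun t : ℕ × ℕ × ℕ => t.2.2 := Primrec.snd.comp Primrec.snd
  have hbig : Primrec fun t : ℕ × ℕ × ℕ => 2 ^ t.2.2 + 1 :=
    Primrec.nat_add.comp (primrec_two_pow.comp hs) (Primrec.const 1)
  refine primrec_option_elim primrec_evalStage hbig
    (primrec_option_elim Primrec.snd (Primrec.const 0) ?_)
  have hs' := hs.comp (Primrec.fst.comp (Primrec.fst (α := (ℕ × ℕ × ℕ) × Option (List Bool))
    (β := List Bool)))
  have hl : Primrec fun t : ((ℕ × ℕ × ℕ) × Option (List Bool)) × List Bool => t.2.length :=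
    Primrec.list_length.comp Primrec.snd
  exact Primrec.ite (Primrec.nat_le.comp hl hs')
    (primrec_two_pow.comp (Primrec.nat_sub.comp hs' hl))
    (hbig.comp (Primrec.fst.comp Primrec.fst))

theorem primrecPred_accepted : PrimrecPred fun t : ℕ × ℕ × ℕ => Accepted t.1 t.2.1 t.2.2 :=
  Primrec.nat_le.comp
    (Primrec.nat_mul.comp
      (primrec_sum_range
        (primrec_stageWeight.comp ((Primrec.fst.comp Primrec.fst).pair
          (Primrec.snd.pair (Primrec.snd.comp (Primrec.snd.comp Primrec.fst)))))
        (Primrec.succ.comp (Primrec.fst.comp Primrec.snd)))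
      (primrec_two_pow.comp (Primrec.nat_add.comp Primrec.fst (Primrec.const 2))))
    (primrec_two_pow.comp (Primrec.snd.comp Primrec.snd))

theorem primrec_stageString : Primrec₂ stageString := by
  have h : Primrec fun t : ℕ × ℕ => (t.1.unpair.1, t.1.unpair.2, t.2) :=
    (Primrec.fst.comp (Primrec.unpair.comp Primrec.fst)).pair
      ((Primrec.snd.comp (Primrec.unpair.comp Primrec.fst)).pair Primrec.snd)
  exact Primrec.ite (primrecPred_accepted.comp h)
    (Primrec.option_bind (primrec_evalStage.comp h) Primrec.snd) (Primrec.const none)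

theorem primrec_stageDensity : Primrec₂ stageDensity := by
  have hs : Primrec fun t : ((ℕ × List Bool) × ℕ) × List Bool => t.1.1.1 :=
    Primrec.fst.comp (Primrec.fst.comp Primrec.fst)
  have hx : Primrec fun t : ((ℕ × List Bool) × ℕ) × List Bool => t.1.1.2 :=
    Primrec.snd.comp (Primrec.fst.comp Primrec.fst)
  have hw : Primrec fun t : ((ℕ × List Bool) × ℕ) × List Bool => t.2 := Primrec.snd
  have hxl := Primrec.list_length.comp hx
  have hwl := Primrec.list_length.comp hw
  refine primrec_sum_range (primrec_option_elim
    (primrec_stageString.comp Primrec.snd (Primrec.fst.comp Primrec.fst)) (Primrec.const 0) ?_)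
    Primrec.fst
  exact Primrec.ite
    (Primrec.eq.comp (Primrec.list_take.comp hxl hw) (Primrec.list_take.comp hwl hx))
    (primrec_two_pow.comp (Primrec.nat_sub.comp hs (Primrec.nat_sub.comp hwl hxl)))
    (Primrec.const 0)

theorem primrec_heavy : Primrec₂ heavy :=
  (Primrec.nat_lt.comp (primrec_two_pow.comp Primrec.snd)
    (Primrec.nat_mul.comp (Primrec.const 2)
      (primrec_stageDensity.comp Primrec.snd Primrec.fst))).decide

end MartinLof

/-- **Existence of an explicitly definable (`Σ⁰₂`) Martin-Löf random sequence.** -/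
theorem exists_sigma2_random :
    ∃ R : ℕ → ℕ → ℕ → Bool,
      Computable (fun t : ℕ × ℕ × ℕ => R t.1 t.2.1 t.2.2) ∧
      ∃ ω : ℕ → Bool,
        (∀ n : ℕ, ω n = true ↔ ∃ p : ℕ, ∀ q : ℕ, R n p q = true) ∧ MLRandom ω :=
  ⟨MartinLof.pathMatrix MartinLof.heavy,
    (MartinLof.primrec_pathMatrix MartinLof.primrec_heavy).to_comp,
    MartinLof.pathSeq fun x => ∃ s, MartinLof.heavy x s = true,
    MartinLof.pathSeq_eq_true_iff MartinLof.heavy, MartinLof.mlRandom_pathSeq_heavy⟩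
end

section
/- Existence of a lower semicomputable random real (Chaitin-style): there exist a computable, strictly increasing sequence of rationals q : ℕ → ℚ with 0 < q n < 1 for all n, converging to a real x ∈ (0,1), and a sequence ω : ℕ → Bool that is not eventually constantly true, such that x = ∑_{n} (if ω n = true then 2^(−(n+1)) else 0) and ω is Martin-Löf random. -/
open Filter MeasureTheory Set
open scoped ENNReal

/-! ### Computability of rational sequences -/

open Encodable in
theorem eqv_rat_eq_count (q : ℚ) :
    Denumerable.eqv ℚ q =
      @Nat.count (· ∈ Set.range (@encode ℚ Rat.instEncodable))
        (@decidableRangeEncode ℚ Rat.instEncodable) (Nat.pair (encode q.num) q.den) :=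
  rfl

theorem natAbs_ofNat_int (n : ℕ) : (Denumerable.ofNat ℤ n).natAbs = (n + 1) / 2 := by
  obtain ⟨z, rfl⟩ := (Denumerable.eqv ℤ).surjective n
  have h : Denumerable.ofNat ℤ (Denumerable.eqv ℤ z) = z := Denumerable.ofNat_encode z
  rw [h]
  rcases z with k | k
  · change k = (2 * k + 1) / 2
    omega
  · change k + 1 = (2 * k + 1 + 1) / 2
    omega

open Encodable in
theorem mem_range_encode_rat_iff (m : ℕ) :
    m ∈ Set.range (@encode ℚ Rat.instEncodable) ↔
      0 < m.unpair.2 ∧ ((m.unpair.1 + 1) / 2).Coprime m.unpair.2 := by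
  constructor
  · rintro ⟨q, rfl⟩
    change 0 < (Nat.pair (encode q.num) q.den).unpair.2 ∧
      (((Nat.pair (encode q.num) q.den).unpair.1 + 1) / 2).Coprime
        (Nat.pair (encode q.num) q.den).unpair.2
    rw [Nat.unpair_pair, ← natAbs_ofNat_int, Denumerable.ofNat_encode]
    exact ⟨q.den_pos, q.reduced⟩
  · rintro ⟨h₁, h₂⟩
    rw [← natAbs_ofNat_int] at h₂
    refine ⟨⟨Denumerable.ofNat ℤ m.unpair.1, m.unpair.2, h₁.ne', h₂⟩, ?_⟩
    change Nat.pair (encode (Denumerable.ofNat ℤ m.unpair.1)) m.unpair.2 = m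
    rw [Denumerable.encode_ofNat, Nat.pair_unpair]

theorem primrecRel_forall_lt {β : Type*} [Primcodable β] {R : ℕ → β → Prop}
    (hR : PrimrecRel R) : PrimrecRel fun (n : ℕ) (b : β) => ∀ x < n, R x b :=
  (hR.forall_mem_list.comp (Primrec.list_range.comp Primrec.fst) Primrec.snd).of_eq (by simp)

theorem primrecRel_dvd : PrimrecRel fun a b : ℕ => a ∣ b :=
  (PrimrecRel.comp (R := fun a b : ℕ => a = b) Primrec.eq
    (Primrec.nat_mod.comp Primrec.snd Primrec.fst) (Primrec.const 0)).of_eq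
    fun _ => (Nat.dvd_iff_mod_eq_zero).symm

theorem coprime_iff_forall_lt {a b : ℕ} (hb : 0 < b) :
    a.Coprime b ↔ ∀ d < b + 1, ¬ (d ∣ a ∧ d ∣ b ∧ d ≠ 1) := by
  constructor
  · rintro h d - ⟨h₁, h₂, h₃⟩
    exact h₃ (Nat.eq_one_of_dvd_coprimes h h₁ h₂)
  · intro h
    by_contra hc
    exact h (a.gcd b) (Nat.lt_succ_of_le (Nat.gcd_le_right _ hb))
      ⟨Nat.gcd_dvd_left _ _, Nat.gcd_dvd_right _ _, hc⟩

theorem primrecRel_pos_and_coprime : PrimrecRel fun a b : ℕ => 0 < b ∧ a.Coprime b := by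
  have h : PrimrecRel fun (d : ℕ) (p : ℕ × ℕ) => ¬ (d ∣ p.1 ∧ d ∣ p.2 ∧ d ≠ 1) :=
    PrimrecPred.not <| PrimrecPred.and
      (primrecRel_dvd.comp Primrec.fst (Primrec.fst.comp Primrec.snd)) <| PrimrecPred.and
      (primrecRel_dvd.comp Primrec.fst (Primrec.snd.comp Primrec.snd)) <|
      PrimrecPred.not (Primrec.eq.comp Primrec.fst (Primrec.const 1))
  have h' : PrimrecPred fun p : ℕ × ℕ => 0 < p.2 ∧ ∀ d < p.2 + 1, ¬ (d ∣ p.1 ∧ d ∣ p.2 ∧ d ≠ 1) :=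
    PrimrecPred.and (Primrec.nat_lt.comp (Primrec.const 0) Primrec.snd)
      (PrimrecRel.comp (R := fun (n : ℕ) (p : ℕ × ℕ) => ∀ d < n, ¬ (d ∣ p.1 ∧ d ∣ p.2 ∧ d ≠ 1))
        (primrecRel_forall_lt h) (Primrec.succ.comp Primrec.snd) Primrec.id)
  exact h'.of_eq fun p => and_congr_right fun hp => (coprime_iff_forall_lt hp).symm

theorem primrec_count {p : ℕ → Prop} [DecidablePred p] (hp : PrimrecPred p) :
    Primrec (Nat.count p) :=
  (Primrec.list_length.comp ((Primrec.listFilter hp).comp Primrec.list_range)).of_eq fun n => by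
    simp [Nat.count, List.countP_eq_length_filter]

/-- A sequence of positive rationals is computable if its reduced numerators and denominators
are. -/
theorem computable_rat_of_num_den {q : ℕ → ℚ} {a b : ℕ → ℕ} (ha : Computable a)
    (hb : Computable b) (hnum : ∀ n, (q n).num = a n) (hden : ∀ n, (q n).den = b n) :
    Computable q := by
  rw [← Computable.encode_iff]
  let _ := @Encodable.decidableRangeEncode ℚ Rat.instEncodable
  have hp : PrimrecPred (· ∈ Set.range (@Encodable.encode ℚ Rat.instEncodable)) :=
    (primrecRel_pos_and_coprime.comp
      (Primrec.nat_div2.comp (Primrec.succ.comp (Primrec.fst.comp Primrec.unpair)))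
      (Primrec.snd.comp Primrec.unpair)).of_eq fun m => by
        rw [mem_range_encode_rat_iff, Nat.div2_val]
  have h2 : Computable fun n => Nat.pair (2 * a n) (b n) :=
    Primrec₂.natPair.to_comp.comp
      (Primrec.nat_mul.to_comp.comp (Computable.const 2) ha) hb
  refine ((primrec_count hp).to_comp.comp h2).of_eq fun n => ?_
  change _ = Denumerable.eqv ℚ (q n)
  rw [eqv_rat_eq_count, hnum, hden]
  rfl

/-! ### Binary values and cylinders -/

/-- The natural number with binary digits `w`, most significant digit first. -/
def strVal (w : List Bool) : ℕ := w.foldl (fun a b => 2 * a + b.toNat) 0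

theorem strVal_append_singleton (w : List Bool) (b : Bool) :
    strVal (w ++ [b]) = 2 * strVal w + b.toNat := by
  simp [strVal]

theorem sum_bits_eq_strVal_prefixFn_div (ω : ℕ → Bool) (m : ℕ) :
    (∑ i ∈ Finset.range m, if ω i = true then (2 : ℝ) ^ (-(i + 1 : ℤ)) else 0) =
      strVal (prefixFn ω m) / 2 ^ m := by
  induction m with
  | zero => simp [prefixFn, strVal]
  | succ m ih =>
    rw [Finset.sum_range_succ, ih, prefixFn_succ, strVal_append_singleton]
    have h : (2 : ℝ) ^ (-(m + 1 : ℤ)) = 1 / 2 ^ (m + 1) := by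
      rw [zpow_neg, one_div]
      norm_cast
    rw [h]
    cases ω m <;> simp <;> field_simp <;> ring

theorem exists_eventually_eq_of_monotone_of_le {f : ℕ → ℕ} {b : ℕ} (hf : Monotone f)
    (hb : ∀ n, f n ≤ b) : ∃ c, ∀ᶠ n in atTop, f n = c := by
  have hbdd : BddAbove (Set.range f) := ⟨b, by rintro _ ⟨n, rfl⟩; exact hb n⟩
  obtain ⟨N, hN⟩ := Nat.sSup_mem (Set.range_nonempty f) hbdd
  refine ⟨f N, eventually_atTop.2 ⟨N, fun n hn => le_antisymm ?_ (hf hn)⟩⟩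
  rw [hN]
  exact le_csSup hbdd ⟨n, rfl⟩

/-- Nondecreasing dyadic approximations `A s / 2 ^ s` in `[0, 1)` converge to a real one of whose
binary expansions is the limit of the expansions of the approximations. -/
theorem exists_binary_expansion_of_dyadic_approx {A : ℕ → ℕ} (hlt : ∀ s, A s < 2 ^ s)
    (hmono : ∀ s, A s ≤ A (s + 1) / 2) :
    ∃ (x : ℝ) (ω : ℕ → Bool), Tendsto (fun s => (A s : ℝ) / 2 ^ s) atTop (nhds x) ∧
      x = (∑' n : ℕ, if ω n = true then (2 : ℝ) ^ (-(n + 1 : ℤ)) else 0) ∧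
      ∀ m, ∀ᶠ s in atTop, A s / 2 ^ (s - m) = strVal (prefixFn ω m) := by
  have hB : ∀ m, ∃ c, ∀ᶠ s in atTop, A s / 2 ^ (s - m) = c := by
    intro m
    have hf : Monotone fun k => A (k + m) / 2 ^ k := by
      refine monotone_nat_of_le_succ fun k => ?_
      have := hmono (k + m)
      rw [pow_succ', ← Nat.div_div_eq_div_mul, add_right_comm]
      exact Nat.div_le_div_right this
    obtain ⟨c, hc⟩ := exists_eventually_eq_of_monotone_of_le (b := 2 ^ m) hf fun k => by
      refine (Nat.div_lt_of_lt_mul ?_).le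
      rw [← pow_add]
      exact hlt _
    obtain ⟨N, hN⟩ := eventually_atTop.1 hc
    refine ⟨c, eventually_atTop.2 ⟨N + m, fun s hs => ?_⟩⟩
    have := hN (s - m) (by omega)
    rwa [Nat.sub_add_cancel (by omega)] at this
  choose B hB using hB
  have hBsucc : ∀ m, B (m + 1) / 2 = B m := by
    intro m
    obtain ⟨s, h₁, h₂, hs⟩ := ((hB m).and ((hB (m + 1)).and (eventually_ge_atTop (m + 1)))).exists
    rw [← h₁, ← h₂, Nat.div_div_eq_div_mul, ← pow_succ]
    congr 2
    omega
  have hB0 : B 0 = 0 := by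
    obtain ⟨s, hs⟩ := (hB 0).exists
    rw [← hs]
    exact Nat.div_eq_of_lt (hlt s)
  set ω : ℕ → Bool := fun m => decide (B (m + 1) % 2 = 1) with hω
  have hval : ∀ m, strVal (prefixFn ω m) = B m := by
    intro m
    induction m with
    | zero => simp [prefixFn, strVal, hB0]
    | succ m ih =>
      rw [prefixFn_succ, strVal_append_singleton, ih, ← hBsucc m]
      rcases Nat.mod_two_eq_zero_or_one (B (m + 1)) with h | h <;> simp [hω, h] <;> omega
  have hmonoR : Monotone fun s => (A s : ℝ) / 2 ^ s := by
    refine monotone_nat_of_le_succ fun s => ?_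
    have h : A s * 2 ≤ A (s + 1) := by have := hmono s; omega
    have h' : (A s : ℝ) * 2 ≤ A (s + 1) := mod_cast h
    rw [div_le_div_iff₀ (by positivity) (by positivity), pow_succ]
    nlinarith [pow_pos (two_pos (α := ℝ)) s]
  have hbddR : BddAbove (Set.range fun s => (A s : ℝ) / 2 ^ s) := by
    refine ⟨1, ?_⟩
    rintro _ ⟨s, rfl⟩
    rw [div_le_one (by positivity)]
    exact_mod_cast (hlt s).le
  have hx := tendsto_atTop_ciSup hmonoR hbddR
  set x := ⨆ s, (A s : ℝ) / 2 ^ s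
  refine ⟨x, ω, hx, ?_, fun m => by rw [hval]; exact hB m⟩
  have hbounds : ∀ m, (B m : ℝ) / 2 ^ m ≤ x ∧ x ≤ (B m : ℝ) / 2 ^ m + (1 / 2) ^ m := by
    intro m
    have key : ∀ᶠ s in atTop, (B m : ℝ) / 2 ^ m ≤ A s / 2 ^ s ∧
        (A s : ℝ) / 2 ^ s ≤ (B m : ℝ) / 2 ^ m + (1 / 2) ^ m := by
      filter_upwards [hB m, eventually_ge_atTop m] with s hs hms
      have hp : (2 : ℕ) ^ s = 2 ^ m * 2 ^ (s - m) := by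
        rw [← pow_add]
        congr 1
        omega
      have hpR : (2 : ℝ) ^ s = 2 ^ m * 2 ^ (s - m) := mod_cast hp
      have h₁ : B m * 2 ^ (s - m) ≤ A s := by rw [← hs]; exact Nat.div_mul_le_self _ _
      have h₂ : A s ≤ (B m + 1) * 2 ^ (s - m) := by
        rw [← hs]
        exact (Nat.lt_mul_of_div_lt (Nat.lt_succ_self _) (by positivity)).le
      have h₁R : (B m : ℝ) * 2 ^ (s - m) ≤ A s := mod_cast h₁
      have h₂R : (A s : ℝ) ≤ (B m + 1) * 2 ^ (s - m) := mod_cast h₂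
      rw [one_div, inv_pow, ← one_div, ← add_div, hpR,
        div_le_div_iff₀ (by positivity) (by positivity),
        div_le_div_iff₀ (by positivity) (by positivity)]
      constructor
      · nlinarith [pow_pos (two_pos (α := ℝ)) m]
      · nlinarith [pow_pos (two_pos (α := ℝ)) m]
    exact ⟨ge_of_tendsto hx (key.mono fun _ h => h.1), le_of_tendsto hx (key.mono fun _ h => h.2)⟩
  refine (HasSum.tsum_eq ?_).symm
  rw [hasSum_iff_tendsto_nat_of_nonneg fun i => by split_ifs <;> positivity]
  simp_rw [sum_bits_eq_strVal_prefixFn_div, hval]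
  have hhalf : Tendsto (fun m : ℕ => x - (1 / 2 : ℝ) ^ m) atTop (nhds x) := by
    simpa using (tendsto_pow_atTop_nhds_zero_of_lt_one (r := (1 / 2 : ℝ)) (by norm_num)
      (by norm_num)).const_sub x
  refine tendsto_of_tendsto_of_tendsto_of_le_of_le hhalf tendsto_const_nhds (fun m => ?_)
    fun m => (hbounds m).1
  linarith [(hbounds m).2]

/-- A sequence that is eventually constant is not Martin-Löf random. -/
theorem MLRandom.not_eventually_eq {ω : ℕ → Bool} (h : MLRandom ω) (b : Bool) :
    ¬ ∀ᶠ n in atTop, ω n = b := by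
  intro hev
  obtain ⟨N, hN⟩ := eventually_atTop.1 hev
  have hpre : ∀ k, prefixFn ω N ++ (List.range k).map (fun _ => b) = prefixFn ω (N + k) := by
    intro k
    induction k with
    | zero => simp
    | succ k ih =>
      rw [List.range_succ, List.map_append, ← List.append_assoc, ih, ← add_assoc, prefixFn_succ]
      simp [hN (N + k) (by omega)]
  have hlen : ∀ k, (prefixFn ω k).length = k := fun k => by simp [prefixFn]
  refine h {ω} ⟨fun k n => if n = 0 then
    some (prefixFn ω N ++ (List.range k).map (fun _ => b)) else none, ?_, fun k => ⟨?_, ?_⟩⟩ rfl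
  · refine Primrec.to_comp (Primrec.ite (Primrec.eq.comp Primrec.snd (Primrec.const 0)) ?_
      (Primrec.const none))
    exact Primrec.option_some.comp (Primrec.list_append.comp (Primrec.const _)
      (Primrec.list_map (Primrec.list_range.comp Primrec.fst) (Primrec.const b).to₂))
  · rintro _ rfl
    refine Set.mem_iUnion.2 ⟨0, Set.mem_iUnion₂.2 ⟨_, rfl, ?_⟩⟩
    rw [hpre]
    simp [cyl, hlen]
  · rw [tsum_eq_single 0 fun n hn => by simp [hn]]
    simp only [hpre, if_true, Option.elim_some, hlen]
    exact ENNReal.inv_le_inv.2 (pow_le_pow_right₀ (by norm_num) (by omega))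

/-! ### A universal Martin-Löf test -/

open Nat.Partrec (Code)

/-- The `j`-th entry of the level `e + 2` of the test computed by the `e`-th program, if it is
found within `s` steps and its length is at most `s`. -/
def testOutput (s e j : ℕ) : Option (Option (List Bool)) :=
  ((Code.evaln s (Denumerable.ofNat Code e) (Nat.pair (e + 2) j)).bind fun r =>
    (Encodable.decode r : Option (Option (List Bool)))).bind fun o =>
      if (o.elim 0 fun w => w.length) ≤ s then some o else none

/-- The measure of the cylinder of `o`, in units of `2 ^ (-s)`. -/
def scaledWeight (s : ℕ) (o : Option (List Bool)) : ℕ :=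
  o.elim 0 fun w => 2 ^ (s - w.length)

/-- The total weight of the first `n` entries of the test computed by the `e`-th program, in units
of `2 ^ (-s)`, if these entries are all found within `s` steps and their measure never exceeds
`2 ^ (-(e + 2))`. -/
def testCost (s e : ℕ) : ℕ → Option ℕ
  | 0 => some 0
  | n + 1 => (testCost s e n).bind fun a => (testOutput s e n).bind fun o =>
      if 2 ^ (e + 2) * (a + scaledWeight s o) ≤ 2 ^ s then some (a + scaledWeight s o) else none

/-- The `n`-th string of the `e`-th test, provided that it is admitted to the universal test at
stage `s`. -/
def accepted (s e n : ℕ) : Option (List Bool) :=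
  (testCost s e (n + 1)).bind fun _ => (testOutput s e n).bind id

/-- The dyadic interval `[a / 2 ^ s, (a + 1) / 2 ^ s)` lies in the cylinder accepted at stage `s`
as the `n`-th string of the `e`-th test. -/
def IsCoveredBy (s e n a : ℕ) : Prop :=
  (accepted s e n).map (fun w => decide (a / 2 ^ (s - w.length) = strVal w)) = some true

theorem isCoveredBy_iff {s e n a : ℕ} : IsCoveredBy s e n a ↔
    ∃ w, accepted s e n = some w ∧ a / 2 ^ (s - w.length) = strVal w := by
  simp [IsCoveredBy]

/-- No string accepted at stage `s` covers the dyadic interval `[a / 2 ^ s, (a + 1) / 2 ^ s)`. -/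
def IsUncovered (s a : ℕ) : Prop :=
  ∀ e < s, ∀ n < s, ¬ IsCoveredBy s e n a

instance (s e n : ℕ) : DecidablePred (IsCoveredBy s e n) := fun _ =>
  inferInstanceAs (Decidable (_ = _))

instance : DecidableRel IsUncovered := fun s a =>
  inferInstanceAs (Decidable (∀ e < s, ∀ n < s, ¬ IsCoveredBy s e n a))

theorem primrec_pow : Primrec₂ ((· ^ ·) : ℕ → ℕ → ℕ) :=
  Primrec₂.unpaired'.1 Nat.Primrec.pow

theorem primrec_strVal : Primrec strVal := by
  have hb : Primrec Bool.toNat := Primrec.dom_finite _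
  exact Primrec.list_foldl Primrec.id (Primrec.const 0)
    (Primrec.nat_add.comp
      (Primrec.nat_mul.comp (Primrec.const 2) (Primrec.fst.comp Primrec.snd))
      (hb.comp (Primrec.snd.comp Primrec.snd))).to₂

theorem primrec_testOutput :
    Primrec fun p : (ℕ × ℕ) × ℕ => testOutput p.1.1 p.1.2 p.2 := by
  have h₁ : Primrec fun p : (ℕ × ℕ) × ℕ =>
      Code.evaln p.1.1 (Denumerable.ofNat Code p.1.2) (Nat.pair (p.1.2 + 2) p.2) :=
    Code.primrec_evaln.comp (Primrec.pair (Primrec.pair (Primrec.fst.comp Primrec.fst)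
      ((Primrec.ofNat Code).comp (Primrec.snd.comp Primrec.fst)))
      (Primrec₂.natPair.comp (Primrec.nat_add.comp (Primrec.snd.comp Primrec.fst)
        (Primrec.const 2)) Primrec.snd))
  have h₂ : Primrec fun o : Option (List Bool) => o.elim 0 fun w => w.length :=
    (Primrec.option_casesOn Primrec.id (Primrec.const 0)
      (Primrec.list_length.comp Primrec.snd).to₂).of_eq fun o => by cases o <;> rfl
  refine Primrec.option_bind (Primrec.option_bind h₁ (Primrec.decode.comp Primrec.snd).to₂)
    (Primrec.ite (Primrec.nat_le.comp (h₂.comp Primrec.snd)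
      (Primrec.fst.comp (Primrec.fst.comp Primrec.fst)))
      (Primrec.option_some.comp Primrec.snd) (Primrec.const none)).to₂

theorem primrec_scaledWeight : Primrec₂ scaledWeight :=
  (Primrec.option_casesOn Primrec.snd (Primrec.const 0)
    (primrec_pow.comp (Primrec.const 2) (Primrec.nat_sub.comp (Primrec.fst.comp Primrec.fst)
      (Primrec.list_length.comp Primrec.snd))).to₂).of_eq fun p => by
        rcases p with ⟨s, _ | w⟩ <;> rfl

theorem primrec_testCost :
    Primrec fun p : (ℕ × ℕ) × ℕ => testCost p.1.1 p.1.2 p.2 := by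
  have hstep : Primrec₂ fun (p : (ℕ × ℕ) × ℕ) (q : ℕ × Option ℕ) =>
      q.2.bind fun a => (testOutput p.1.1 p.1.2 q.1).bind fun o =>
        if 2 ^ (p.1.2 + 2) * (a + scaledWeight p.1.1 o) ≤ 2 ^ p.1.1
        then some (a + scaledWeight p.1.1 o) else none := by
    refine Primrec.option_bind (Primrec.snd.comp Primrec.snd) ?_
    refine Primrec.option_bind (primrec_testOutput.comp (Primrec.pair
      (Primrec.fst.comp (Primrec.fst.comp Primrec.fst))
      (Primrec.fst.comp (Primrec.snd.comp Primrec.fst)))) ?_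
    have hse : Primrec fun x : ((((ℕ × ℕ) × ℕ) × ℕ × Option ℕ) × ℕ) × Option (List Bool) =>
        x.1.1.1.1 :=
      Primrec.fst.comp (Primrec.fst.comp (Primrec.fst.comp Primrec.fst))
    have hsum : Primrec fun x : ((((ℕ × ℕ) × ℕ) × ℕ × Option ℕ) × ℕ) × Option (List Bool) =>
        x.1.2 + scaledWeight x.1.1.1.1.1 x.2 :=
      Primrec.nat_add.comp (Primrec.snd.comp Primrec.fst)
        (primrec_scaledWeight.comp (Primrec.fst.comp hse) Primrec.snd)
    exact Primrec.ite (Primrec.nat_le.comp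
      (Primrec.nat_mul.comp (primrec_pow.comp (Primrec.const 2)
        (Primrec.nat_add.comp (Primrec.snd.comp hse) (Primrec.const 2))) hsum)
      (primrec_pow.comp (Primrec.const 2) (Primrec.fst.comp hse)))
      (Primrec.option_some.comp hsum) (Primrec.const none)
  refine (Primrec.nat_rec' Primrec.snd (Primrec.const (some 0)) hstep).of_eq fun p => ?_
  induction p.2 with
  | zero => rfl
  | succ n ih => simp only [ih, testCost]

theorem primrec_accepted :
    Primrec fun p : (ℕ × ℕ) × ℕ => accepted p.1.1 p.1.2 p.2 :=
  Primrec.option_bind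
    (primrec_testCost.comp (Primrec.pair Primrec.fst (Primrec.succ.comp Primrec.snd)))
    (Primrec.option_bind (primrec_testOutput.comp Primrec.fst) Primrec.snd.to₂).to₂

theorem primrecRel_isUncovered : PrimrecRel IsUncovered := by
  have hcov : PrimrecPred fun p : ((ℕ × ℕ) × ℕ) × ℕ => IsCoveredBy p.1.1.1 p.1.1.2 p.1.2 p.2 := by
    refine Primrec.eq.comp (Primrec.option_map (primrec_accepted.comp Primrec.fst) ?_)
      (Primrec.const (some true))
    exact PrimrecPred.decide (Primrec.eq.comp
      (Primrec.nat_div.comp (Primrec.snd.comp Primrec.fst) (primrec_pow.comp (Primrec.const 2)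
        (Primrec.nat_sub.comp (Primrec.fst.comp (Primrec.fst.comp (Primrec.fst.comp Primrec.fst)))
          (Primrec.list_length.comp Primrec.snd))))
      (primrec_strVal.comp Primrec.snd))
  have h₁ : PrimrecRel fun (n : ℕ) (q : ℕ × ℕ × ℕ) => ¬ IsCoveredBy q.2.1 q.1 n q.2.2 :=
    PrimrecPred.not <| hcov.comp (Primrec.pair (Primrec.pair (Primrec.pair
      (Primrec.fst.comp (Primrec.snd.comp Primrec.snd)) (Primrec.fst.comp Primrec.snd))
      Primrec.fst) (Primrec.snd.comp (Primrec.snd.comp Primrec.snd)))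
  have h₂ : PrimrecRel fun (e : ℕ) (q : ℕ × ℕ) => ∀ n < q.1, ¬ IsCoveredBy q.1 e n q.2 :=
    PrimrecRel.comp (R := fun (N : ℕ) (q : ℕ × ℕ × ℕ) =>
      ∀ n < N, ¬ IsCoveredBy q.2.1 q.1 n q.2.2) (primrecRel_forall_lt h₁)
      (Primrec.fst.comp Primrec.snd) Primrec.id
  exact PrimrecRel.comp (R := fun (N : ℕ) (q : ℕ × ℕ) =>
    ∀ e < N, ∀ n < q.1, ¬ IsCoveredBy q.1 e n q.2) (primrecRel_forall_lt h₂) Primrec.fst Primrec.id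

theorem testOutput_succ {s e j : ℕ} {o : Option (List Bool)} (h : testOutput s e j = some o) :
    testOutput (s + 1) e j = some o ∧ (o.elim 0 fun w => w.length) ≤ s := by
  simp only [testOutput, Option.bind_eq_some_iff, Option.ite_none_right_eq_some,
    Option.some.injEq] at h ⊢
  obtain ⟨_, ⟨r, hr, ho⟩, hs, rfl⟩ := h
  exact ⟨⟨_, ⟨r, Code.evaln_mono (Nat.le_succ s) hr, ho⟩, by omega, rfl⟩, hs⟩

theorem scaledWeight_succ {s : ℕ} {o : Option (List Bool)}
    (h : (o.elim 0 fun w => w.length) ≤ s) : scaledWeight (s + 1) o = 2 * scaledWeight s o := by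
  cases o with
  | none => rfl
  | some w =>
    have h' : w.length ≤ s := h
    simp only [scaledWeight, Option.elim_some]
    rw [Nat.succ_sub h', pow_succ, mul_comm]

theorem testCost_succ_stage {s e : ℕ} :
    ∀ {n a : ℕ}, testCost s e n = some a → testCost (s + 1) e n = some (2 * a)
  | 0, a, h => by
    obtain rfl : 0 = a := Option.some.inj h
    rfl
  | n + 1, a, h => by
    simp only [testCost, Option.bind_eq_some_iff, Option.ite_none_right_eq_some,
      Option.some.injEq] at h ⊢
    obtain ⟨b, hb, o, ho, hle, rfl⟩ := h
    obtain ⟨ho', hs⟩ := testOutput_succ ho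
    refine ⟨_, testCost_succ_stage hb, o, ho', ?_, ?_⟩
    · rw [scaledWeight_succ hs, pow_succ 2 s]
      linarith
    · rw [scaledWeight_succ hs]
      ring

theorem accepted_succ_stage {s e n : ℕ} {w : List Bool} (h : accepted s e n = some w) :
    accepted (s + 1) e n = some w ∧ w.length ≤ s := by
  simp only [accepted, Option.bind_eq_some_iff, id] at h ⊢
  obtain ⟨a, ha, o, ho, rfl⟩ := h
  obtain ⟨ho', hs⟩ := testOutput_succ ho
  exact ⟨⟨_, testCost_succ_stage ha, _, ho', rfl⟩, hs⟩

theorem IsUncovered.div_two {s a : ℕ} (h : IsUncovered (s + 1) a) : IsUncovered s (a / 2) := by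
  intro e he n hn hc
  refine h e (by omega) n (by omega) ?_
  obtain ⟨w, hw, hv⟩ := isCoveredBy_iff.1 hc
  obtain ⟨hw', hs⟩ := accepted_succ_stage hw
  refine isCoveredBy_iff.2 ⟨w, hw', ?_⟩
  rw [← hv, Nat.succ_sub hs, pow_succ', Nat.div_div_eq_div_mul]

theorem sum_scaledWeight_accepted_le (s e N : ℕ) :
    2 ^ (e + 2) * ∑ n ∈ Finset.range N, scaledWeight s (accepted s e n) ≤ 2 ^ s := by
  have key : (∀ a, testCost s e N = some a →
      ∑ n ∈ Finset.range N, scaledWeight s (accepted s e n) = a) ∧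
      2 ^ (e + 2) * ∑ n ∈ Finset.range N, scaledWeight s (accepted s e n) ≤ 2 ^ s := by
    induction N with
    | zero => exact ⟨fun a h => Option.some.inj h, by simp⟩
    | succ N ih =>
      rw [Finset.sum_range_succ]
      cases hc : testCost s e (N + 1) with
      | none =>
        have : accepted s e N = none := by simp [accepted, hc]
        simpa [this, scaledWeight] using ih.2
      | some a =>
        have hc' := hc
        simp only [testCost, Option.bind_eq_some_iff, Option.ite_none_right_eq_some,
          Option.some.injEq] at hc'
        obtain ⟨b, hb, o, ho, hle, rfl⟩ := hc'
        have : accepted s e N = o := by simp [accepted, hc, ho]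
        rw [this, ih.1 b hb]
        exact ⟨fun a h => Option.some.inj h, hle⟩
  exact key.2

theorem sum_budgets_le {B : ℕ → ℕ} {M : ℕ} (hB : ∀ e, 2 ^ (e + 2) * B e ≤ M) (E : ℕ) :
    2 * ∑ e ∈ Finset.range E, B e ≤ M := by
  have key : 2 ^ (E + 1) * ∑ e ∈ Finset.range E, B e + M ≤ 2 ^ E * M := by
    induction E with
    | zero => simp
    | succ E ih =>
      have h₁ := hB E
      rw [Finset.sum_range_succ, mul_add]
      simp only [pow_succ] at *
      linarith
  refine Nat.le_of_mul_le_mul_left (c := 2 ^ E) ?_ (by positivity)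
  rw [← mul_assoc, ← pow_succ]
  omega

theorem two_mul_le_of_forall_lt_not_isUncovered {s M : ℕ} (h : ∀ a < M, ¬ IsUncovered s a) :
    2 * M ≤ 2 ^ s := by
  let I : ℕ → ℕ → Finset ℕ := fun e n => (accepted s e n).elim ∅ fun w =>
    Finset.Ico (strVal w * 2 ^ (s - w.length)) ((strVal w + 1) * 2 ^ (s - w.length))
  have hI : ∀ e n, (I e n).card = scaledWeight s (accepted s e n) := by
    intro e n
    cases hw : accepted s e n with
    | none => simp [I, hw, scaledWeight]
    | some w => simp [I, hw, scaledWeight, add_mul]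
  have hsub : Finset.range M ⊆
      (Finset.range s).biUnion fun e => (Finset.range s).biUnion fun n => I e n := by
    intro a ha
    have := h a (Finset.mem_range.1 ha)
    simp only [IsUncovered, not_forall, not_not] at this
    obtain ⟨e, he, n, hn, hc⟩ := this
    obtain ⟨w, hw, hv⟩ := isCoveredBy_iff.1 hc
    refine Finset.mem_biUnion.2 ⟨e, Finset.mem_range.2 he,
      Finset.mem_biUnion.2 ⟨n, Finset.mem_range.2 hn, ?_⟩⟩
    simp only [I, hw, Option.elim_some, Finset.mem_Ico]
    rw [← hv]
    exact ⟨Nat.div_mul_le_self _ _, Nat.lt_mul_of_div_lt (Nat.lt_succ_self _) (by positivity)⟩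
  have hcard : M ≤ ∑ e ∈ Finset.range s, ∑ n ∈ Finset.range s, scaledWeight s (accepted s e n) :=
    calc M = (Finset.range M).card := (Finset.card_range M).symm
      _ ≤ _ := Finset.card_le_card hsub
      _ ≤ ∑ e ∈ Finset.range s, ((Finset.range s).biUnion fun n => I e n).card :=
        Finset.card_biUnion_le
      _ ≤ ∑ e ∈ Finset.range s, ∑ n ∈ Finset.range s, (I e n).card :=
        Finset.sum_le_sum fun e _ => Finset.card_biUnion_le
      _ = _ := by simp_rw [hI]
  exact (Nat.mul_le_mul_left 2 hcard).trans
    (sum_budgets_le (fun e => sum_scaledWeight_accepted_le s e s) s)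

theorem exists_isUncovered (s : ℕ) : ∃ a, IsUncovered s a := by
  by_contra! h
  have := two_mul_le_of_forall_lt_not_isUncovered (s := s) (M := 2 ^ s) fun a _ => h a
  have := Nat.two_pow_pos s
  omega

/-- The index of the leftmost dyadic interval of length `2 ^ (-s)` that is uncovered at
stage `s`. -/
def leftmost (s : ℕ) : ℕ := Nat.find (exists_isUncovered s)

theorem isUncovered_leftmost (s : ℕ) : IsUncovered s (leftmost s) :=
  Nat.find_spec (exists_isUncovered s)

theorem two_mul_leftmost_le (s : ℕ) : 2 * leftmost s ≤ 2 ^ s :=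
  two_mul_le_of_forall_lt_not_isUncovered fun _ ha => Nat.find_min (exists_isUncovered s) ha

theorem leftmost_le_leftmost_succ_div_two (s : ℕ) : leftmost s ≤ leftmost (s + 1) / 2 :=
  Nat.find_min' (exists_isUncovered s) (isUncovered_leftmost (s + 1)).div_two

theorem computable_leftmost : Computable leftmost :=
  Computable.find (PrimrecPred.computablePred primrecRel_isUncovered) exists_isUncovered

theorem pow_mul_sum_scaledWeight_le {s k N : ℕ} {o : ℕ → Option (List Bool)}
    (hlen : ∀ j < N, ((o j).elim 0 fun w => w.length) ≤ s)
    (hsum : (∑' n : ℕ, ((o n).elim 0 fun w => ((2 : ℝ≥0∞) ^ w.length)⁻¹)) ≤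
      ((2 : ℝ≥0∞) ^ k)⁻¹) :
    2 ^ k * ∑ j ∈ Finset.range N, scaledWeight s (o j) ≤ 2 ^ s := by
  have hw : ∀ j ∈ Finset.range N, ((scaledWeight s (o j) : ℕ) : ℝ≥0∞) =
      2 ^ s * ((o j).elim 0 fun w => ((2 : ℝ≥0∞) ^ w.length)⁻¹) := by
    intro j hj
    have hl := hlen j (Finset.mem_range.1 hj)
    cases ho : o j with
    | none => simp [scaledWeight]
    | some w =>
      rw [ho] at hl
      have hl' : w.length ≤ s := hl
      simp only [scaledWeight, Option.elim_some, Nat.cast_pow, Nat.cast_ofNat]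
      rw [← div_eq_mul_inv, ENNReal.eq_div_iff (by simp) (by simp),
        ← pow_add]
      congr 1
      omega
  have h : (2 : ℝ≥0∞) ^ k * ∑ j ∈ Finset.range N, ((scaledWeight s (o j) : ℕ) : ℝ≥0∞) ≤ 2 ^ s := by
    rw [Finset.sum_congr rfl hw, ← Finset.mul_sum]
    calc (2 : ℝ≥0∞) ^ k * (2 ^ s * _) ≤ 2 ^ k * (2 ^ s * (2 ^ k)⁻¹) := by
          gcongr
          exact (ENNReal.sum_le_tsum _).trans hsum
      _ = 2 ^ s * (2 ^ k * (2 ^ k)⁻¹) := by ring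
      _ = 2 ^ s := by rw [ENNReal.mul_inv_cancel (by simp) (by simp), mul_one]
  exact_mod_cast h

theorem eventually_testOutput_eq {g : ℕ → ℕ → Option (List Bool)} {c : Code}
    (hc : c.eval = fun p : ℕ => Part.some (Encodable.encode (g p.unpair.1 p.unpair.2))) (j : ℕ) :
    ∀ᶠ s in atTop, testOutput s (Encodable.encode c) j = some (g (Encodable.encode c + 2) j) ∧
      ((g (Encodable.encode c + 2) j).elim 0 fun w => w.length) ≤ s := by
  have h : Encodable.encode (g (Encodable.encode c + 2) j) ∈
      c.eval (Nat.pair (Encodable.encode c + 2) j) := by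
    rw [hc]
    simp
  obtain ⟨t, ht⟩ := Code.evaln_complete.1 h
  filter_upwards [eventually_ge_atTop t,
    eventually_ge_atTop ((g (Encodable.encode c + 2) j).elim 0 fun w => w.length)] with s hs hl
  refine ⟨?_, hl⟩
  have := Code.evaln_mono hs ht
  rw [Option.mem_def] at this
  simp only [testOutput, Denumerable.ofNat_encode, this, Option.bind_some, Encodable.encodek]
  rw [if_pos hl]

theorem eventually_accepted_eq {g : ℕ → ℕ → Option (List Bool)} {c : Code}
    (hc : c.eval = fun p : ℕ => Part.some (Encodable.encode (g p.unpair.1 p.unpair.2)))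
    (hsum : ∀ k, (∑' n : ℕ, ((g k n).elim 0 fun w => ((2 : ℝ≥0∞) ^ w.length)⁻¹)) ≤
      ((2 : ℝ≥0∞) ^ k)⁻¹) (n : ℕ) :
    ∀ᶠ s in atTop, accepted s (Encodable.encode c) n = g (Encodable.encode c + 2) n := by
  set e := Encodable.encode c with he
  have hall : ∀ᶠ s in atTop, ∀ j ∈ Finset.range (n + 1), testOutput s e j = some (g (e + 2) j) ∧
      ((g (e + 2) j).elim 0 fun w => w.length) ≤ s :=
    (Filter.eventually_all_finset _).2 fun j _ => eventually_testOutput_eq hc j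
  filter_upwards [hall] with s hs
  have hcost : ∀ i ≤ n + 1,
      testCost s e i = some (∑ j ∈ Finset.range i, scaledWeight s (g (e + 2) j)) := by
    intro i
    induction i with
    | zero => exact fun _ => rfl
    | succ i ih =>
      intro hi
      have hle := pow_mul_sum_scaledWeight_le (s := s) (N := i + 1)
        (fun j hj => (hs j (Finset.mem_range.2 (by omega))).2) (hsum (e + 2))
      rw [Finset.sum_range_succ] at hle ⊢
      simp only [testCost, ih (by omega), (hs i (Finset.mem_range.2 (by omega))).1,
        Option.bind_some]
      rw [if_pos hle]
  simp [accepted, hcost (n + 1) le_rfl, (hs n (by simp)).1]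

theorem mlRandom_of_eventually_leftmost_div_eq {ω : ℕ → Bool}
    (h : ∀ m, ∀ᶠ s in atTop, leftmost s / 2 ^ (s - m) = strVal (prefixFn ω m)) :
    MLRandom ω := by
  rintro X ⟨g, hg, hX⟩ hω
  have hg' : Nat.Partrec fun p : ℕ => Part.some (Encodable.encode (g p.unpair.1 p.unpair.2)) :=
    Partrec.nat_iff.1 <| Computable.partrec <| Computable.encode.comp <|
      hg.comp (Computable.fst.comp Computable.unpair) (Computable.snd.comp Computable.unpair)
  obtain ⟨c, hc⟩ := Code.exists_code.1 hg'
  set e := Encodable.encode c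
  obtain ⟨n, hn⟩ := Set.mem_iUnion.1 ((hX (e + 2)).1 hω)
  obtain ⟨w, hw, hcyl⟩ := Set.mem_iUnion₂.1 hn
  have hpre : prefixFn ω w.length = w := hcyl
  obtain ⟨s, hacc, hval, hs⟩ := ((eventually_accepted_eq hc (fun k => (hX k).2) n).and
    ((h w.length).and (eventually_gt_atTop (max e n)))).exists
  rw [hpre] at hval
  exact isUncovered_leftmost s e (by omega) n (by omega)
    (isCoveredBy_iff.2 ⟨w, hacc.trans hw, hval⟩)

/-- **Existence of a lower semicomputable Martin-Löf random real (à la Chaitin).**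
There is a computable strictly increasing sequence of rationals in `(0,1)` converging to
a real `x ∈ (0,1)` whose binary expansion (taken not eventually all `true`) is a
Martin-Löf random sequence. -/
theorem exists_lower_semicomputable_random_real :
    ∃ q : ℕ → ℚ, Computable q ∧ StrictMono q ∧ (∀ n, 0 < q n ∧ q n < 1) ∧
      ∃ x : ℝ, x ∈ Set.Ioo (0 : ℝ) 1 ∧
        Tendsto (fun n => ((q n : ℝ))) atTop (nhds x) ∧
        ∃ ω : ℕ → Bool, ¬ (∀ᶠ n in atTop, ω n = true) ∧
          x = (∑' n : ℕ, if ω n = true then (2 : ℝ) ^ (-(n + 1 : ℤ)) else 0) ∧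
          MLRandom ω := by
  have hlt : ∀ s, leftmost s < 2 ^ s := fun s => by
    have := two_mul_leftmost_le s
    have := Nat.two_pow_pos s
    omega
  obtain ⟨x, ω, hx, hxω, hω⟩ :=
    exists_binary_expansion_of_dyadic_approx hlt leftmost_le_leftmost_succ_div_two
  have hrand : MLRandom ω := mlRandom_of_eventually_leftmost_div_eq hω
  obtain ⟨S, hS⟩ : ∃ S, 0 < leftmost S := by
    by_contra! h
    refine hrand.not_eventually_eq false (Eventually.of_forall fun m => ?_)
    obtain ⟨s, hs⟩ := (hω (m + 1)).exists
    rw [Nat.le_zero.1 (h s), prefixFn_succ, strVal_append_singleton, Nat.zero_div] at hs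
    cases hm : ω m with
    | false => rfl
    | true => simp [hm] at hs
  have hpos : ∀ n, 0 < leftmost (n + S) := by
    intro n
    induction n with
    | zero => simpa using hS
    | succ n ih =>
      have := leftmost_le_leftmost_succ_div_two (n + S)
      rw [add_right_comm]
      omega
  let a : ℕ → ℕ := fun n => 2 * leftmost (n + S) - 1
  let b : ℕ → ℕ := fun n => 2 ^ (n + S + 1)
  have hshift : Computable fun n => n + S := (Primrec.nat_add.comp .id (.const S)).to_comp
  have ha : Computable a := (Primrec.nat_sub.comp
    (Primrec.nat_mul.comp (.const 2) .id) (.const 1)).to_comp.comp (computable_leftmost.comp hshift)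
  have hb : Computable b := (primrec_pow.comp (.const 2) (.succ)).to_comp.comp hshift
  have haR : ∀ n, (a n : ℝ) = 2 * leftmost (n + S) - 1 := fun n => by
    have := hpos n
    simp only [a]
    rw [Nat.cast_sub (by omega)]
    push_cast
    ring
  have hcop : ∀ n, Nat.Coprime (a n) (b n) := fun n => by
    refine Nat.Coprime.pow_right _ (Nat.coprime_two_right.2 ?_)
    have := hpos n
    exact ⟨leftmost (n + S) - 1, by simp only [a]; omega⟩
  let q : ℕ → ℚ := fun n => ⟨a n, b n, by positivity, hcop n⟩
  have hqR : ∀ n, (q n : ℝ) = leftmost (n + S) / 2 ^ (n + S) - 1 / 2 ^ (n + S + 1) := fun n => by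
    rw [Rat.cast_def]
    simp only [q, Int.cast_natCast, haR, b]
    push_cast
    rw [pow_succ]
    field_simp
  have hqmono : StrictMono q := by
    refine strictMono_nat_of_lt_succ fun n => ?_
    rw [← Rat.cast_lt (K := ℝ), hqR, hqR]
    have h₁ : 2 * leftmost (n + S) ≤ leftmost (n + 1 + S) := by
      have := leftmost_le_leftmost_succ_div_two (n + S)
      rw [add_right_comm]
      omega
    have h₂ : 2 * (leftmost (n + S) : ℝ) ≤ leftmost (n + 1 + S) := mod_cast h₁
    have h₃ : (2 : ℝ) ^ (n + 1 + S) = 2 * 2 ^ (n + S) := by ring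
    rw [pow_succ _ (n + S), pow_succ _ (n + 1 + S), h₃, ← sub_pos]
    have h₄ : (leftmost (n + 1 + S) : ℝ) / (2 * 2 ^ (n + S)) - 1 / (2 * 2 ^ (n + S) * 2) -
        (leftmost (n + S) / 2 ^ (n + S) - 1 / (2 ^ (n + S) * 2)) =
        (2 * (leftmost (n + 1 + S) - 2 * leftmost (n + S)) + 1) / (2 * 2 ^ (n + S) * 2) := by
      field_simp
      ring
    rw [h₄]
    apply div_pos _ (by positivity)
    linarith
  have hqlim : Tendsto (fun n => (q n : ℝ)) atTop (nhds x) := by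
    simp_rw [hqR]
    have h₁ := hx.comp (tendsto_add_atTop_nat S)
    have h₂ := (tendsto_pow_atTop_nhds_zero_of_lt_one (r := (1 / 2 : ℝ)) (by norm_num)
      (by norm_num)).comp (tendsto_add_atTop_nat (S + 1))
    simpa [Function.comp_def, add_assoc] using h₁.sub h₂
  have hqpos : ∀ n, 0 < q n := fun n => by
    rw [← Rat.num_pos]
    have := hpos n
    simp only [q, a]
    omega
  have hqmonoR : Monotone fun n => (q n : ℝ) := fun m n h => Rat.cast_le.2 (hqmono.monotone h)
  have hqle : ∀ n, (q n : ℝ) ≤ x := fun n => hqmonoR.ge_of_tendsto hqlim n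
  have hx1 : x < 1 := by
    refine (le_of_tendsto' hx (b := 1 / 2) fun s => ?_).trans_lt (by norm_num)
    have : (2 * leftmost s : ℝ) ≤ 2 ^ s := mod_cast two_mul_leftmost_le s
    rw [div_le_div_iff₀ (by positivity) (by positivity)]
    linarith
  refine ⟨q, computable_rat_of_num_den ha hb (fun _ => rfl) (fun _ => rfl), hqmono,
    fun n => ⟨hqpos n, ?_⟩, x, ⟨?_, hx1⟩, hqlim, ω, hrand.not_eventually_eq true, hxω, hrand⟩
  · exact_mod_cast (hqle n).trans_lt hx1
  · exact (Rat.cast_pos.2 (hqpos 0)).trans_le (hqle 0)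
end
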